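/- arXiv:2410.21460 — 2 statements merged into one kernel-verified Lean document; each statement's English description precedes it below -/
import Mathlib

section
/- Let f be a homeomorphism of ℝ² such that: (a) f maps every C¹ curve to a C¹ curve; (b) f induces a homeomorphism φ_q of projective tangent spaces at every point q ∈ ℝ²; and (c) for every transverse sequence (pₙ, kₙ), the sequence ((f(pₙ), φ_{pₙ}(kₙ))) is a transverse sequence. Then f⁻¹ also maps every C¹ curve to a C¹ curve; hence f ∈ Homeo¹(ℝ²). -/
open Filter Topology

noncomputable section

abbrev Plane : Type := ℝ × ℝ

abbrev ProjLine : Type := Projectivization ℝ Plane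

instance : TopologicalSpace ProjLine := instTopologicalSpaceQuotient

/-- A regular (C¹, 1-periodic, injective on `[0,1)`, nowhere-vanishing derivative)
parameterization of a simple closed C¹ curve. -/
def IsRegParam (γ : ℝ → Plane) : Prop :=
  ContDiff ℝ 1 γ ∧ Function.Periodic γ 1 ∧ Set.InjOn γ (Set.Ico 0 1) ∧ ∀ t, deriv γ t ≠ 0

/-- `Γ` is a simple closed C¹ curve. -/
def IsC1Curve (Γ : Set Plane) : Prop := ∃ γ : ℝ → Plane, IsRegParam γ ∧ Γ = Set.range γ

/-- `Γ` is a simple closed C¹ curve through `p` with tangent line `ℓ` at `p`. -/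
def TangentAt (Γ : Set Plane) (p : Plane) (ℓ : ProjLine) : Prop :=
  ∃ (γ : ℝ → Plane) (t₀ : ℝ) (h : IsRegParam γ),
    Γ = Set.range γ ∧ γ t₀ = p ∧ ℓ = Projectivization.mk ℝ (deriv γ t₀) (h.2.2.2 t₀)

/-- `f` maps every simple closed C¹ curve to a simple closed C¹ curve. -/
def MapsC1 (f : Plane → Plane) : Prop := ∀ Γ : Set Plane, IsC1Curve Γ → IsC1Curve (f '' Γ)

/-- Membership in `Homeo¹(ℝ²)`. -/
def InHomeo1 (f : Plane ≃ₜ Plane) : Prop := MapsC1 ⇑f ∧ MapsC1 ⇑f.symm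

/-- `φ` is a homeomorphism of projective tangent spaces induced by `f` at `p`. -/
def InducesAt (f : Plane → Plane) (p : Plane) (φ : ProjLine ≃ₜ ProjLine) : Prop :=
  ∀ (Γ : Set Plane) (ℓ : ProjLine), TangentAt Γ p ℓ →
    IsC1Curve (f '' Γ) ∧ TangentAt (f '' Γ) (f p) (φ ℓ)

/-- The secant direction from `q` to `x` (junk value if `x = q`). -/
def secantDir (q x : Plane) : ProjLine :=
  if h : x = q then Projectivization.mk ℝ (1, 0) (by simp) else
    Projectivization.mk ℝ (x - q) (sub_ne_zero.mpr h)

/-- The sequence `x` converges along the line `ℓ` to `p`. -/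
def ConvAlong (p : Plane) (ℓ : ProjLine) (x : ℕ → Plane) : Prop :=
  (∀ n, x n ≠ p) ∧ Tendsto x atTop (𝓝 p) ∧
    Tendsto (fun n => secantDir p (x n)) atTop (𝓝 ℓ)

/-- `(x, k)` is a transverse sequence for `(p, ℓ)`. -/
def TransverseFor (p : Plane) (ℓ : ProjLine) (x : ℕ → Plane) (k : ℕ → ProjLine) : Prop :=
  ConvAlong p ℓ x ∧
    ∀ φ : ℕ → ℕ, StrictMono φ →
      ¬ Tendsto (fun n => (x (φ n), k (φ n))) atTop (𝓝 (p, ℓ))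

/-- `(x, k)` is a transverse sequence. -/
def Transverse (x : ℕ → Plane) (k : ℕ → ProjLine) : Prop := ∃ p ℓ, TransverseFor p ℓ x k


/-- Near `t₀`, the forward secants of `c` point in a direction close to `v`. -/
def HasDirection {E : Type*} [NormedAddCommGroup E] [NormedSpace ℝ E]
    (c : ℝ → E) (t₀ : ℝ) (v : E) : Prop :=
  ‖v‖ = 1 ∧ ∀ ε > 0, ∃ δ > 0, ∀ s ∈ Set.Ioo (t₀ - δ) (t₀ + δ), ∀ t ∈ Set.Ioo (t₀ - δ) (t₀ + δ),
    s ≤ t → ‖c t - c s - ‖c t - c s‖ • v‖ ≤ ε * ‖c t - c s‖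

section Rectification

variable {E : Type*} [NormedAddCommGroup E]

/-- The arc length of `c`, measured from `0`. -/
def arcLength (c : ℝ → E) (t : ℝ) : ℝ := variationOnFromTo c Set.univ 0 t

theorem norm_sub_le_arcLength_sub {c : ℝ → E} (hc : LocallyBoundedVariationOn c Set.univ)
    {s t : ℝ} (hst : s ≤ t) : ‖c t - c s‖ ≤ arcLength c t - arcLength c s := by
  rw [arcLength, arcLength, variationOnFromTo.sub_right hc trivial trivial trivial,
    variationOnFromTo.eq_of_le _ _ hst, ← dist_eq_norm, dist_edist]
  exact ENNReal.toReal_mono (hc s t trivial trivial)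
    (eVariationOn.edist_le _ ⟨trivial, hst, le_rfl⟩ ⟨trivial, le_rfl, hst⟩)

theorem arcLength_add_period {c : ℝ → E} (hc : LocallyBoundedVariationOn c Set.univ)
    {T : ℝ} (hp : Function.Periodic c T) (t : ℝ) :
    arcLength c (t + T) = arcLength c t + arcLength c T := by
  have hcomp : c ∘ (fun x => x + T) = c := funext hp
  have himg : (fun x : ℝ => x + T) '' Set.univ = Set.univ := by
    rw [Set.image_univ]
    exact (Equiv.addRight T).range_eq_univ
  have h1 := variationOnFromTo.comp_eq_of_monotoneOn c (t := Set.univ) (fun x : ℝ => x + T)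
    (fun a _ b _ hab => by simpa using hab) (Set.mem_univ 0) (Set.mem_univ t)
  rw [hcomp, himg, zero_add] at h1
  have h2 := variationOnFromTo.add hc (Set.mem_univ 0) (Set.mem_univ T) (Set.mem_univ (t + T))
  rw [arcLength, arcLength, arcLength, ← h2, h1, add_comm]

theorem strictMono_arcLength {c : ℝ → E} (hc : LocallyBoundedVariationOn c Set.univ)
    (hinj : ∀ s t, s < t → t < s + 1 → c s ≠ c t) : StrictMono (arcLength c) := by
  intro s t hst
  set u := min t (s + 1 / 2) with hu
  have hsu : s < u := lt_min hst (by linarith)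
  have hut : u ≤ t := min_le_left _ _
  have hus : u < s + 1 := lt_of_le_of_lt (min_le_right _ _) (by linarith)
  have h1 := norm_sub_le_arcLength_sub hc hsu.le
  have h2 := norm_sub_le_arcLength_sub hc hut
  have h3 : 0 < ‖c u - c s‖ := norm_pos_iff.2 (sub_ne_zero.2 (hinj s u hsu hus).symm)
  have h4 := norm_nonneg (c t - c u)
  linarith

variable [NormedSpace ℝ E]

theorem eVariationOn_Icc_le_of_secants {c : ℝ → E} {v : E} {ε a b : ℝ} (hv : ‖v‖ = 1)
    (hε : ε < 1) (hab : a ≤ b)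
    (h : ∀ s ∈ Set.Icc a b, ∀ t ∈ Set.Icc a b, s ≤ t →
      ‖c t - c s - ‖c t - c s‖ • v‖ ≤ ε * ‖c t - c s‖) :
    eVariationOn c (Set.Icc a b) ≤ ENNReal.ofReal (‖c b - c a‖ / (1 - ε)) := by
  refine iSup_le fun ⟨n, u, hu, hmem⟩ => ?_
  have hsum : ∑ i ∈ Finset.range n, edist (c (u (i + 1))) (c (u i))
      = ENNReal.ofReal (∑ i ∈ Finset.range n, ‖c (u (i + 1)) - c (u i)‖) := by
    rw [ENNReal.ofReal_sum_of_nonneg fun i _ => norm_nonneg _]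
    exact Finset.sum_congr rfl fun i _ => by rw [edist_dist, dist_eq_norm]
  change ∑ i ∈ Finset.range n, edist (c (u (i + 1))) (c (u i)) ≤ _
  rw [hsum]
  refine ENNReal.ofReal_le_ofReal ?_
  rw [le_div_iff₀ (by linarith)]
  set A := ∑ i ∈ Finset.range n, ‖c (u (i + 1)) - c (u i)‖ with hA
  have htel : ∑ i ∈ Finset.range n, (c (u (i + 1)) - c (u i)) = c (u n) - c (u 0) :=
    Finset.sum_range_sub (fun i => c (u i)) n
  have hmid : ‖c (u n) - c (u 0) - A • v‖ ≤ ε * A := by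
    rw [← htel, hA, Finset.sum_smul, ← Finset.sum_sub_distrib, Finset.mul_sum]
    exact norm_sum_le_of_le _ fun i _ => h _ (hmem i) _ (hmem _) (hu (Nat.le_succ i))
  have ha := h a ⟨le_rfl, hab⟩ (u 0) (hmem 0) (hmem 0).1
  have hb := h (u n) (hmem n) b ⟨hab, le_rfl⟩ (hmem n).2
  have hA0 : 0 ≤ A := Finset.sum_nonneg fun i _ => norm_nonneg _
  set p := ‖c (u 0) - c a‖
  set q := ‖c b - c (u n)‖
  have hp0 : 0 ≤ p := norm_nonneg _
  have hq0 : 0 ≤ q := norm_nonneg _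
  have htot : ‖c b - c a - (p + A + q) • v‖ ≤ ε * (p + A + q) := by
    have : c b - c a - (p + A + q) • v = (c (u 0) - c a - p • v)
        + (c (u n) - c (u 0) - A • v) + (c b - c (u n) - q • v) := by
      simp only [add_smul]; abel
    rw [this]
    refine (norm_add₃_le).trans ?_
    linarith
  have hn : ‖(p + A + q) • v‖ = p + A + q := by
    rw [norm_smul, hv, mul_one, Real.norm_of_nonneg (by positivity)]
  have := norm_sub_norm_le ((p + A + q) • v) (c b - c a)
  rw [norm_sub_rev _ (c b - c a), hn] at this
  nlinarith

theorem locallyBoundedVariationOn_of_hasDirection {c : ℝ → E}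
    (h : ∀ t, ∃ v, HasDirection c t v) : LocallyBoundedVariationOn c Set.univ := by
  have key : ∀ x y : ℝ, eVariationOn c (Set.Icc x y) ≠ ⊤ := by
    refine PreconnectedSpace.induction₂' _ (fun x => ?_) ⟨fun x y z hxy hyz => ?_⟩
    · obtain ⟨v, hv, hd⟩ := h x
      obtain ⟨δ, hδ, H⟩ := hd (1 / 2) (by norm_num)
      have fin : ∀ s ∈ Set.Ioo (x - δ) (x + δ), ∀ t ∈ Set.Ioo (x - δ) (x + δ),
          eVariationOn c (Set.Icc s t) ≠ ⊤ := by
        intro s hs t ht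
        rcases le_or_gt s t with hst | hst
        · refine ne_top_of_le_ne_top ENNReal.ofReal_ne_top
            (eVariationOn_Icc_le_of_secants hv (ε := 1 / 2) (by norm_num) hst ?_)
          intro a ha b hb
          exact H a (Set.ordConnected_Ioo.out hs ht ha) b (Set.ordConnected_Ioo.out hs ht hb)
        · simp [Set.Icc_eq_empty (not_le.2 hst), eVariationOn.subsingleton]
      have hx : x ∈ Set.Ioo (x - δ) (x + δ) := ⟨by linarith, by linarith⟩
      filter_upwards [isOpen_Ioo.mem_nhds hx] with y hy
      exact ⟨fin x hx y hy, fin y hy x hx⟩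
    · rcases le_total x y with h1 | h1
      · rcases le_total y z with h2 | h2
        · have := eVariationOn.Icc_add_Icc c (s := Set.univ) h1 h2 trivial
          simp only [Set.univ_inter] at this
          rw [← this]
          exact ENNReal.add_ne_top.2 ⟨hxy, hyz⟩
        · exact ne_top_of_le_ne_top hxy (eVariationOn.mono _ (Set.Icc_subset_Icc le_rfl h2))
      · exact ne_top_of_le_ne_top hyz (eVariationOn.mono _ (Set.Icc_subset_Icc h1 le_rfl))
  intro a b _ _
  rw [Set.univ_inter]
  exact key a b

theorem continuous_of_hasStrictDerivAt {g g' : ℝ → E} (h : ∀ x, HasStrictDerivAt g (g' x) x) :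
    Continuous g' := by
  refine continuous_iff_continuousAt.2 fun x => Metric.continuousAt_iff'.2 fun ε hε => ?_
  have h1 := (h x).hasStrictFDerivAt.isLittleO.bound (half_pos hε)
  have hdiag : Tendsto (fun y : ℝ => (y, y)) (𝓝 x) (𝓝 (x, x)) :=
    (continuous_id.prodMk continuous_id).tendsto x
  filter_upwards [hdiag.eventually (eventually_eventually_nhds.2 h1)] with y hy
  have h2 : HasDerivAt (fun z => g z - z • g' x) (g' y - g' x) y := by
    simpa using! (h y).hasDerivAt.sub ((hasDerivAt_id y).smul_const (g' x))
  rw [dist_eq_norm]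
  refine lt_of_le_of_lt (h2.le_of_lip' (half_pos hε).le ?_) (half_lt_self hε)
  have hpair : Tendsto (fun z : ℝ => (z, y)) (𝓝 y) (𝓝 (y, y)) :=
    (continuous_id.prodMk continuous_const).tendsto y
  filter_upwards [hpair.eventually hy] with z hz
  convert! hz using 2
  rw [ContinuousLinearMap.toSpanSingleton_apply]
  module

theorem arcLength_sub_le {c : ℝ → E} (hc : LocallyBoundedVariationOn c Set.univ)
    {v : E} {ε s t : ℝ} (hv : ‖v‖ = 1) (hε : ε < 1) (hst : s ≤ t)
    (h : ∀ a ∈ Set.Icc s t, ∀ b ∈ Set.Icc s t, a ≤ b →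
      ‖c b - c a - ‖c b - c a‖ • v‖ ≤ ε * ‖c b - c a‖) :
    arcLength c t - arcLength c s ≤ ‖c t - c s‖ / (1 - ε) := by
  rw [arcLength, arcLength, variationOnFromTo.sub_right hc trivial trivial trivial,
    variationOnFromTo.eq_of_le _ _ hst, Set.univ_inter]
  exact ENNReal.toReal_le_of_le_ofReal (div_nonneg (norm_nonneg _) (by linarith))
    (eVariationOn_Icc_le_of_secants hv hε hst h)

theorem HasDirection.arcLength_estimate {c : ℝ → E} (hc : LocallyBoundedVariationOn c Set.univ)
    {t₀ : ℝ} {v : E} (h : HasDirection c t₀ v) {ε : ℝ} (hε : 0 < ε) (hε' : ε ≤ 1 / 2) :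
    ∃ δ > 0, ∀ s ∈ Set.Ioo (t₀ - δ) (t₀ + δ), ∀ t ∈ Set.Ioo (t₀ - δ) (t₀ + δ), s ≤ t →
      arcLength c t - arcLength c s ≤ 2 * ‖c t - c s‖ ∧
      ‖c t - c s - (arcLength c t - arcLength c s) • v‖
        ≤ 3 * ε * (arcLength c t - arcLength c s) := by
  obtain ⟨δ, hδ, H⟩ := h.2 ε hε
  refine ⟨δ, hδ, fun s hs t ht hst => ?_⟩
  have hlow := norm_sub_le_arcLength_sub hc hst
  have hup := arcLength_sub_le hc h.1 (by linarith : ε < 1) hst fun a ha b hb =>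
    H a (Set.ordConnected_Ioo.out hs ht ha) b (Set.ordConnected_Ioo.out hs ht hb)
  have hH := H s hs t ht hst
  rw [le_div_iff₀ (by linarith)] at hup
  set n := ‖c t - c s‖
  set L := arcLength c t - arcLength c s
  have hn : 0 ≤ n := norm_nonneg _
  have hsplit : c t - c s - L • v = (c t - c s - n • v) - (L - n) • v := by
    module
  refine ⟨by nlinarith, ?_⟩
  rw [hsplit]
  refine (norm_sub_le _ _).trans ?_
  rw [norm_smul, h.1, mul_one, Real.norm_of_nonneg (by linarith)]
  nlinarith

theorem continuous_arcLength {c : ℝ → E} (hc : LocallyBoundedVariationOn c Set.univ)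
    (hcont : Continuous c) (h : ∀ t, ∃ v, HasDirection c t v) : Continuous (arcLength c) := by
  refine continuous_iff_continuousAt.2 fun t₀ => ?_
  obtain ⟨v, hv⟩ := h t₀
  obtain ⟨δ, hδ, H⟩ := hv.arcLength_estimate hc (ε := 1 / 2) (by norm_num) le_rfl
  have ht₀ : t₀ ∈ Set.Ioo (t₀ - δ) (t₀ + δ) := ⟨by linarith, by linarith⟩
  have hlim : Tendsto (fun t => 2 * ‖c t - c t₀‖) (𝓝 t₀) (𝓝 0) := by
    have : Continuous fun t => 2 * ‖c t - c t₀‖ := by fun_prop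
    simpa using this.tendsto t₀
  rw [ContinuousAt, tendsto_iff_dist_tendsto_zero]
  refine squeeze_zero' (Eventually.of_forall fun _ => dist_nonneg) ?_ hlim
  filter_upwards [isOpen_Ioo.mem_nhds ht₀] with t ht
  rw [Real.dist_eq]
  rcases le_total t₀ t with hle | hle
  · have := norm_sub_le_arcLength_sub hc hle
    have h0 := norm_nonneg (c t - c t₀)
    rw [abs_of_nonneg (by linarith)]
    exact (H t₀ ht₀ t ht hle).1
  · have := norm_sub_le_arcLength_sub hc hle
    have h0 := norm_nonneg (c t₀ - c t)
    rw [abs_of_nonpos (by linarith), neg_sub, norm_sub_rev]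
    exact (H t ht t₀ ht₀ hle).1

theorem exists_contDiff_reparam {c : ℝ → E} (hcont : Continuous c)
    (hper : Function.Periodic c 1) (hinj : ∀ s t, s < t → t < s + 1 → c s ≠ c t)
    (h : ∀ t, ∃ v, HasDirection c t v) :
    ∃ γ : ℝ → E, ContDiff ℝ 1 γ ∧ Function.Periodic γ 1 ∧ Set.InjOn γ (Set.Ico 0 1) ∧
      (∀ t, deriv γ t ≠ 0) ∧ Set.range γ = Set.range c := by
  have hc := locallyBoundedVariationOn_of_hasDirection h
  have hmono := strictMono_arcLength hc hinj
  have hLc := continuous_arcLength hc hcont h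
  have hL0 : arcLength c 0 = 0 := variationOnFromTo.self _ _ _
  set K := arcLength c 1 with hK
  have hKpos : 0 < K := hL0 ▸ hmono one_pos
  have hLper : ∀ t, arcLength c (t + 1) = arcLength c t + K := arcLength_add_period hc hper
  have hLnat : ∀ n : ℕ, arcLength c n = n * K := by
    intro n
    induction n with
    | zero => simp [hL0]
    | succ n ih => push_cast; rw [hLper, ih]; ring
  have hLneg : ∀ n : ℕ, arcLength c (-n) = -(n * K) := by
    intro n
    induction n with
    | zero => simp [hL0]
    | succ n ih =>
      have := hLper (-(n + 1 : ℕ))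
      have e : (-((n + 1 : ℕ) : ℝ) + 1) = -n := by push_cast; ring
      rw [e, ih] at this
      push_cast at this ⊢
      linarith
  have hsurj : Function.Surjective (arcLength c) := by
    intro y
    obtain ⟨n, hn⟩ := exists_nat_gt (|y| / K)
    rw [div_lt_iff₀ hKpos] at hn
    have := abs_lt.1 hn
    obtain ⟨x, -, hx⟩ := intermediate_value_Icc (f := arcLength c) (a := -(n : ℝ)) (b := n)
      (by linarith [(Nat.cast_nonneg n : (0 : ℝ) ≤ n)]) hLc.continuousOn
      (show y ∈ _ from ⟨by rw [hLneg]; linarith, by rw [hLnat]; linarith⟩)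
    exact ⟨x, hx⟩
  let e : ℝ ≃o ℝ := hmono.orderIsoOfSurjective _ hsurj
  have he : ∀ t, e t = arcLength c t := fun _ => rfl
  have heL : ∀ u, arcLength c (e.symm u) = u := fun u => e.apply_symm_apply u
  have hes : ∀ u, e.symm (u + K) = e.symm u + 1 := by
    intro u
    rw [OrderIso.symm_apply_eq, he, hLper, heL]
  choose v hv using h
  have hderiv : ∀ u, HasStrictDerivAt (fun u => c (e.symm u)) (v (e.symm u)) u := by
    intro u
    refine HasStrictFDerivAt.of_isLittleO (Asymptotics.isLittleO_iff.2 fun η hη => ?_)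
    obtain ⟨δ, hδ, H⟩ := (hv (e.symm u)).arcLength_estimate hc
      (ε := min (η / 3) (1 / 2)) (by positivity) (min_le_right _ _)
    have hmem : e.symm u ∈ Set.Ioo (e.symm u - δ) (e.symm u + δ) :=
      ⟨by linarith, by linarith⟩
    have hnear := e.symm.continuous.continuousAt.eventually (isOpen_Ioo.mem_nhds hmem)
    rw [nhds_prod_eq]
    filter_upwards [hnear.prod_mk hnear] with p hp
    have hηle : 3 * min (η / 3) (1 / 2) ≤ η := by linarith [min_le_left (η / 3) (1 / 2)]
    have main : ∀ a b : ℝ, a ≤ b → e.symm a ∈ Set.Ioo (e.symm u - δ) (e.symm u + δ) →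
        e.symm b ∈ Set.Ioo (e.symm u - δ) (e.symm u + δ) →
        ‖c (e.symm b) - c (e.symm a) - (b - a) • v (e.symm u)‖ ≤ η * (b - a) := by
      intro a b hab ha hb
      have := (H _ ha _ hb (e.symm.monotone hab)).2
      rw [heL, heL] at this
      exact this.trans (mul_le_mul_of_nonneg_right hηle (by linarith))
    simp only [ContinuousLinearMap.toSpanSingleton_apply]
    rcases le_total p.2 p.1 with hle | hle
    · rw [Real.norm_of_nonneg (by linarith)]
      exact main _ _ hle hp.2 hp.1
    · rw [Real.norm_of_nonpos (by linarith), neg_sub]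
      convert! main _ _ hle hp.1 hp.2 using 1
      rw [← norm_neg]
      congr 1
      module
  have hγ : ∀ u, HasDerivAt (fun u => c (e.symm (K * u))) (K • v (e.symm (K * u))) u := by
    intro u
    have h1 : HasDerivAt (fun u : ℝ => K * u) K u := by
      simpa using (hasDerivAt_id u).const_mul K
    exact (hderiv (K * u)).hasDerivAt.scomp u h1
  have hvcont : Continuous fun u => v (e.symm u) := continuous_of_hasStrictDerivAt hderiv
  refine ⟨fun u => c (e.symm (K * u)), ?_, ?_, ?_, ?_, ?_⟩
  · refine contDiff_one_iff_deriv.2 ⟨fun u => (hγ u).differentiableAt, ?_⟩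
    rw [funext fun u => (hγ u).deriv]
    exact continuous_const.smul (hvcont.comp (continuous_const.mul continuous_id))
  · intro u
    simp only [mul_add, mul_one, hes]
    exact hper _
  · have hlt : ∀ a ∈ Set.Ico (0 : ℝ) 1, ∀ b ∈ Set.Ico (0 : ℝ) 1, a < b →
        c (e.symm (K * a)) ≠ c (e.symm (K * b)) := by
      intro a ha b hb hab
      refine hinj _ _ (e.symm.strictMono (by gcongr)) ?_
      rw [← hes]
      exact e.symm.strictMono (by nlinarith [ha.1, hb.2])
    intro a ha b hb hab
    rcases lt_trichotomy a b with h1 | h1 | h1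
    · exact absurd hab (hlt a ha b hb h1)
    · exact h1
    · exact absurd hab.symm (hlt b hb a ha h1)
  · intro u
    rw [(hγ u).deriv]
    refine smul_ne_zero hKpos.ne' fun h0 => ?_
    simpa [h0] using (hv (e.symm (K * u))).1
  · refine Set.Subset.antisymm ?_ ?_
    · rintro _ ⟨u, rfl⟩
      exact ⟨_, rfl⟩
    · rintro _ ⟨t, rfl⟩
      refine ⟨e t / K, ?_⟩
      simp only [mul_div_cancel₀ _ hKpos.ne', OrderIso.symm_apply_apply]

end Rectification

/-- The Euclidean inner product on the plane. -/
def dot (a b : Plane) : ℝ := a.1 * b.1 + a.2 * b.2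

/-- The rotation of a vector by a right angle. -/
def perp (v : Plane) : Plane := (-v.2, v.1)

theorem dot_self_pos {v : Plane} (hv : v ≠ 0) : 0 < dot v v := by
  by_contra! h
  have h1 : v.1 = 0 := by unfold dot at h; nlinarith [mul_self_nonneg v.1, mul_self_nonneg v.2]
  have h2 : v.2 = 0 := by unfold dot at h; nlinarith [mul_self_nonneg v.1, mul_self_nonneg v.2]
  exact hv (Prod.ext h1 h2)

theorem dot_smul (v w : Plane) (a : ℝ) : dot v (a • w) = a * dot v w := by
  simp only [dot, Prod.smul_fst, Prod.smul_snd, smul_eq_mul]; ring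

theorem perp_ne_zero {v : Plane} (hv : v ≠ 0) : perp v ≠ 0 := by
  intro h
  simp only [perp, Prod.mk_eq_zero, neg_eq_zero] at h
  exact hv (Prod.ext h.2 h.1)

@[fun_prop]
theorem Continuous.dot {X : Type*} [TopologicalSpace X] {g h : X → Plane} (hg : Continuous g)
    (hh : Continuous h) : Continuous fun x => dot (g x) (h x) := by
  unfold _root_.dot
  fun_prop

/-- The line spanned by `w` (junk value if `w = 0`). -/
def dir (w : Plane) : ProjLine :=
  if h : w = 0 then Projectivization.mk ℝ (1, 0) (by simp) else Projectivization.mk ℝ w h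

theorem dir_of_ne_zero {w : Plane} (h : w ≠ 0) : dir w = Projectivization.mk ℝ w h := dif_neg h

theorem secantDir_eq_dir (q x : Plane) : secantDir q x = dir (x - q) := by
  simp only [secantDir, dir, sub_eq_zero]

theorem exists_dir_eq (ℓ : ProjLine) : ∃ v : Plane, v ≠ 0 ∧ dir v = ℓ :=
  ⟨ℓ.rep, ℓ.rep_nonzero, by rw [dir_of_ne_zero ℓ.rep_nonzero, ℓ.mk_rep]⟩

theorem dir_eq_dir_iff {v w : Plane} (hv : v ≠ 0) (hw : w ≠ 0) :
    dir v = dir w ↔ dot (perp v) w = 0 := by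
  rw [dir_of_ne_zero hv, dir_of_ne_zero hw, Projectivization.mk_eq_mk_iff']
  constructor
  · rintro ⟨a, rfl⟩
    simp only [dot, perp, Prod.smul_fst, Prod.smul_snd, smul_eq_mul]
    ring
  · intro h
    have hpos := dot_self_pos hw
    refine ⟨dot w v / dot w w, ?_⟩
    ext
    · simp only [Prod.smul_fst, smul_eq_mul]
      rw [div_mul_eq_mul_div, div_eq_iff hpos.ne']
      simp only [dot, perp] at h ⊢
      linear_combination (-w.2) * h
    · simp only [Prod.smul_snd, smul_eq_mul]
      rw [div_mul_eq_mul_div, div_eq_iff hpos.ne']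
      simp only [dot, perp] at h ⊢
      linear_combination w.1 * h

theorem dir_smul {w : Plane} {a : ℝ} (ha : a ≠ 0) (hw : w ≠ 0) : dir (a • w) = dir w := by
  rw [dir_eq_dir_iff (smul_ne_zero ha hw) hw]
  simp only [dot, perp, Prod.smul_fst, Prod.smul_snd, smul_eq_mul]
  ring

theorem dir_perp_ne_dir {v : Plane} (hv : v ≠ 0) : dir (perp v) ≠ dir v := by
  rw [Ne, dir_eq_dir_iff (perp_ne_zero hv) hv]
  have := dot_self_pos hv
  simp only [dot, perp] at this ⊢
  linarith

theorem continuousAt_dir {v : Plane} (hv : v ≠ 0) : ContinuousAt dir v := by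
  have hopen : IsOpen {w : Plane | w ≠ 0} := isOpen_ne
  refine ContinuousOn.continuousAt ?_ (hopen.mem_nhds hv)
  rw [continuousOn_iff_continuous_domRestrict]
  have : Set.domRestrict {w : Plane | w ≠ 0} dir
      = fun w => Quotient.mk (projectivizationSetoid ℝ Plane) w := by
    ext w
    exact dir_of_ne_zero w.2
  rw [this]
  exact continuous_quotient_mk'

/-- A homogeneous open condition satisfied by `v` is satisfied by all vectors whose direction
is close to that of `v`. -/
theorem eventually_mem_of_tendsto_dir {ι : Type*} {F : Filter ι} {w : ι → Plane} {v : Plane}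
    (hv : v ≠ 0) (hw : ∀ᶠ i in F, w i ≠ 0) (hlim : Tendsto (fun i => dir (w i)) F (𝓝 (dir v)))
    {U : Set Plane} (hU : IsOpen U) (hhom : ∀ x ∈ U, ∀ a : ℝ, a ≠ 0 → a • x ∈ U) (hvU : v ∈ U) :
    ∀ᶠ i in F, w i ∈ U := by
  have hiff : ∀ x : Plane, x ≠ 0 → ((dir x).rep ∈ U ↔ x ∈ U) := by
    intro x hx
    have := Projectivization.mk_rep (dir x)
    rw [dir_of_ne_zero hx, Projectivization.mk_eq_mk_iff] at this
    obtain ⟨a, ha⟩ := this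
    have ha' : (a : ℝ) • x = (Projectivization.mk ℝ x hx).rep := ha
    rw [dir_of_ne_zero hx, ← ha']
    refine ⟨fun h => ?_, fun h => hhom x h a a.ne_zero⟩
    simpa [smul_smul] using hhom _ h (a : ℝ)⁻¹ (inv_ne_zero a.ne_zero)
  have hopen : IsOpen {ℓ : ProjLine | ℓ.rep ∈ U} := by
    refine isQuotientMap_quotient_mk'.isOpen_preimage.1 ?_
    have : Quotient.mk' (s := projectivizationSetoid ℝ Plane) ⁻¹' {ℓ : ProjLine | ℓ.rep ∈ U}
        = {x : { v : Plane // v ≠ 0 } | (x : Plane) ∈ U} := by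
      ext x
      have := hiff x x.2
      rw [dir_of_ne_zero x.2] at this
      exact this
    exact (congrArg IsOpen this).mpr (hU.preimage continuous_subtype_val)
  filter_upwards [hw, hlim.eventually (hopen.mem_nhds ((hiff v hv).2 hvU))] with i hi hi'
  exact (hiff _ hi).1 hi'

/-- The double-angle map. -/
def doubleAngle (ℓ : ProjLine) : ℝ × ℝ :=
  Projectivization.lift
    (fun w : { v : Plane // v ≠ 0 } =>
      (((w : Plane).1 ^ 2 - (w : Plane).2 ^ 2) / dot w w,
        (2 * (w : Plane).1 * (w : Plane).2) / dot w w))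
    (by
      rintro ⟨a, ha⟩ ⟨b, hb⟩ t (rfl : a = t • b)
      have ht : t ≠ 0 := by rintro rfl; simp at ha
      have := (dot_self_pos hb).ne'
      ext
      · simp only [dot, Prod.smul_fst, Prod.smul_snd, smul_eq_mul] at this ⊢
        have h2 : t * b.1 * (t * b.1) + t * b.2 * (t * b.2) ≠ 0 := by
          convert! mul_ne_zero (pow_ne_zero 2 ht) this using 1; ring
        rw [div_eq_div_iff h2 this]; ring
      · simp only [dot, Prod.smul_fst, Prod.smul_snd, smul_eq_mul] at this ⊢
        have h2 : t * b.1 * (t * b.1) + t * b.2 * (t * b.2) ≠ 0 := by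
          convert! mul_ne_zero (pow_ne_zero 2 ht) this using 1; ring
        rw [div_eq_div_iff h2 this]; ring) ℓ

theorem continuous_doubleAngle : Continuous doubleAngle := by
  refine continuous_quot_lift _ ?_
  have h : ∀ w : { v : Plane // v ≠ 0 }, dot w w ≠ 0 := fun w => (dot_self_pos w.2).ne'
  fun_prop (disch := assumption)

theorem doubleAngle_injective : Function.Injective doubleAngle := by
  intro ℓ m h
  obtain ⟨v, hv, rfl⟩ := exists_dir_eq ℓ
  obtain ⟨w, hw, rfl⟩ := exists_dir_eq m
  rw [dir_eq_dir_iff hv hw]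
  rw [dir_of_ne_zero hv, dir_of_ne_zero hw] at h
  simp only [doubleAngle, Projectivization.lift_mk, Prod.mk.injEq] at h
  obtain ⟨h1, h2⟩ := h
  have hv' := (dot_self_pos hv).ne'
  have hw' := (dot_self_pos hw).ne'
  rw [div_eq_div_iff hv' hw'] at h1 h2
  simp only [dot, perp] at *
  have hsq : (-v.2 * w.1 + v.1 * w.2) ^ 2 * (w.1 * w.1 + w.2 * w.2) = 0 := by
    linear_combination -(1 / 2) * (w.1 ^ 2 - w.2 ^ 2) * h1 - (1 / 2) * (2 * w.1 * w.2) * h2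
  simpa [hw'] using hsq

instance : T2Space ProjLine :=
  T2Space.of_injective_continuous doubleAngle_injective continuous_doubleAngle

instance : CompactSpace ProjLine := by
  have hcont : ContinuousOn dir (Metric.sphere (0 : Plane) 1) := fun v hv =>
    (continuousAt_dir (ne_zero_of_mem_unit_sphere ⟨v, hv⟩)).continuousWithinAt
  have himg : dir '' Metric.sphere (0 : Plane) 1 = Set.univ := by
    refine Set.eq_univ_of_forall fun ℓ => ?_
    obtain ⟨v, hv, rfl⟩ := exists_dir_eq ℓ
    have hn : ‖v‖ ≠ 0 := norm_ne_zero_iff.2 hv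
    exact ⟨‖v‖⁻¹ • v, by simp [norm_smul, hn], dir_smul (inv_ne_zero hn) hv⟩
  exact ⟨himg ▸ (isCompact_sphere _ _).image_of_continuousOn hcont⟩

instance : FirstCountableTopology ProjLine :=
  (continuous_doubleAngle.isClosedEmbedding doubleAngle_injective).isInducing.firstCountableTopology

theorem tendsto_secantDir_of_hasDerivAt {δ : ℝ → Plane} {δ' : Plane} {s₀ : ℝ}
    (h : HasDerivAt δ δ' s₀) (h0 : δ' ≠ 0) :
    Tendsto (fun s => secantDir (δ s₀) (δ s)) (𝓝[≠] s₀) (𝓝 (dir δ')) := by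
  have h1 := hasDerivAt_iff_tendsto_slope.1 h
  have h2 : Tendsto (fun s => dir (slope δ s₀ s)) (𝓝[≠] s₀) (𝓝 (dir δ')) :=
    (continuousAt_dir h0).tendsto.comp h1
  refine h2.congr' ?_
  filter_upwards [self_mem_nhdsWithin, h1.eventually_ne h0] with s hs hne
  rw [secantDir_eq_dir, slope_def_module] at *
  exact dir_smul (inv_ne_zero (sub_ne_zero.2 hs)) (smul_ne_zero_iff.1 hne).2

/-- The circle through `q` with centre `q + u`, parameterized on `[0, 1)`. -/
def circleParam (q u : Plane) (t : ℝ) : Plane :=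
  q + u - Real.cos (2 * Real.pi * t) • u + Real.sin (2 * Real.pi * t) • perp u

theorem hasDerivAt_circleParam (q u : Plane) (t : ℝ) :
    HasDerivAt (circleParam q u)
      ((2 * Real.pi) • (Real.sin (2 * Real.pi * t) • u + Real.cos (2 * Real.pi * t) • perp u))
      t := by
  have h1 : HasDerivAt (fun t : ℝ => 2 * Real.pi * t) (2 * Real.pi) t := by
    simpa using (hasDerivAt_id t).const_mul (2 * Real.pi)
  have h2 := ((h1.cos.smul_const u).const_sub (q + u)).add (h1.sin.smul_const (perp u))
  convert! h2 using 1
  module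

theorem isRegParam_circleParam (q : Plane) {u : Plane} (hu : u ≠ 0) :
    IsRegParam (circleParam q u) := by
  have hpos := dot_self_pos hu
  refine ⟨?_, ?_, ?_, ?_⟩
  · unfold circleParam
    fun_prop
  · intro t
    simp only [circleParam, mul_add, mul_one, Real.cos_add_two_pi, Real.sin_add_two_pi]
  · intro s hs t ht hst
    have h1 : Real.cos (2 * Real.pi * s) = Real.cos (2 * Real.pi * t) := by
      have := congrArg (dot u) hst
      simp only [circleParam, dot, perp, Prod.fst_add, Prod.snd_add, Prod.fst_sub, Prod.snd_sub,
        Prod.smul_fst, Prod.smul_snd, smul_eq_mul] at this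
      refine mul_right_cancel₀ hpos.ne' ?_
      unfold dot
      linarith
    have h2 : Real.sin (2 * Real.pi * s) = Real.sin (2 * Real.pi * t) := by
      have := congrArg (dot (perp u)) hst
      simp only [circleParam, dot, perp, Prod.fst_add, Prod.snd_add, Prod.fst_sub, Prod.snd_sub,
        Prod.smul_fst, Prod.smul_snd, smul_eq_mul] at this
      refine mul_right_cancel₀ hpos.ne' ?_
      unfold dot
      linarith
    obtain ⟨n, hn⟩ := Real.Angle.angle_eq_iff_two_pi_dvd_sub.1 (Real.Angle.cos_sin_inj h1 h2)
    have h3 : s - t = n := by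
      have : (2 * Real.pi) ≠ 0 := by positivity
      apply mul_left_cancel₀ this
      linarith
    have h4 : (n : ℝ) < 1 := by linarith [hs.2, ht.1]
    have h5 : (-1 : ℝ) < n := by linarith [hs.1, ht.2]
    have h6 : n = 0 := by
      have : n < 1 := by exact_mod_cast h4
      have : -1 < n := by exact_mod_cast h5
      omega
    rw [h6] at h3
    push_cast at h3
    linarith
  · intro t h0
    rw [(hasDerivAt_circleParam q u t).deriv] at h0
    have h1 := (smul_eq_zero.1 h0).resolve_left (by positivity)
    have hs : Real.sin (2 * Real.pi * t) = 0 := by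
      have := congrArg (dot u) h1
      simp only [dot, perp, Prod.fst_add, Prod.snd_add, Prod.fst_zero, Prod.snd_zero,
        Prod.smul_fst, Prod.smul_snd, smul_eq_mul] at this
      refine mul_right_cancel₀ hpos.ne' ?_
      unfold dot
      linarith
    have hc : Real.cos (2 * Real.pi * t) = 0 := by
      have := congrArg (dot (perp u)) h1
      simp only [dot, perp, Prod.fst_add, Prod.snd_add, Prod.fst_zero, Prod.snd_zero,
        Prod.smul_fst, Prod.smul_snd, smul_eq_mul] at this
      refine mul_right_cancel₀ hpos.ne' ?_
      unfold dot
      linarith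
    simpa [hs, hc] using Real.sin_sq_add_cos_sq (2 * Real.pi * t)

theorem dot_sub_self_of_mem_circle {q u x : Plane} (hx : x ∈ Set.range (circleParam q u)) :
    dot (x - q) (x - q) = 2 * dot u (x - q) := by
  obtain ⟨t, rfl⟩ := hx
  have h := Real.sin_sq_add_cos_sq (2 * Real.pi * t)
  simp only [circleParam, dot, perp, Prod.fst_add, Prod.snd_add, Prod.fst_sub, Prod.snd_sub,
    Prod.smul_fst, Prod.smul_snd, smul_eq_mul]
  linear_combination (u.1 ^ 2 + u.2 ^ 2) * h

theorem IsRegParam.tangentAt {γ : ℝ → Plane} (h : IsRegParam γ) (t : ℝ) :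
    TangentAt (Set.range γ) (γ t) (dir (deriv γ t)) :=
  ⟨γ, t, h, rfl, rfl, dir_of_ne_zero _⟩

theorem IsRegParam.hasDerivAt {γ : ℝ → Plane} (h : IsRegParam γ) (t : ℝ) :
    HasDerivAt γ (deriv γ t) t :=
  (h.1.differentiable one_ne_zero t).hasDerivAt

theorem tangentAt_circle (q : Plane) {u : Plane} (hu : u ≠ 0) :
    TangentAt (Set.range (circleParam q u)) q (dir (perp u)) := by
  have h := (isRegParam_circleParam q hu).tangentAt 0
  have h0 : circleParam q u 0 = q := by simp [circleParam]
  have h1 : deriv (circleParam q u) 0 = (2 * Real.pi) • perp u := by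
    simpa using (hasDerivAt_circleParam q u 0).deriv
  rwa [h0, h1, dir_smul (by positivity) (perp_ne_zero hu)] at h

theorem IsRegParam.ne_of_lt {γ : ℝ → Plane} (h : IsRegParam γ) {s t : ℝ} (hst : s < t)
    (hts : t < s + 1) : γ s ≠ γ t := by
  intro heq
  have hfr : ∀ r, γ (Int.fract r) = γ r := fun r => by
    have := h.2.1.sub_int_mul_eq (x := r) ⌊r⌋
    rwa [mul_one] at this
  have h1 : Int.fract s = Int.fract t :=
    h.2.2.1 ⟨Int.fract_nonneg s, Int.fract_lt_one s⟩ ⟨Int.fract_nonneg t, Int.fract_lt_one t⟩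
      (by rw [hfr, hfr, heq])
  obtain ⟨n, hn⟩ := Int.fract_eq_fract.1 h1
  have h2 : (n : ℝ) < 0 := by linarith
  have h3 : (-1 : ℝ) < n := by linarith
  have h4 : n < 0 := by exact_mod_cast h2
  have h5 : -1 < n := by exact_mod_cast h3
  omega

theorem IsRegParam.eventually_ne {γ : ℝ → Plane} (h : IsRegParam γ) (t : ℝ) :
    ∀ᶠ s in 𝓝[≠] t, γ s ≠ γ t := by
  have hmem : Set.Ioo (t - 1) (t + 1) ∈ 𝓝 t := Ioo_mem_nhds (by linarith) (by linarith)
  filter_upwards [mem_nhdsWithin_of_mem_nhds hmem, self_mem_nhdsWithin] with s hs hne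
  rcases lt_or_gt_of_ne hne with hlt | hlt
  · exact h.ne_of_lt hlt (by linarith [hs.1])
  · exact (h.ne_of_lt hlt hs.2).symm

theorem IsRegParam.convAlong {γ : ℝ → Plane} (h : IsRegParam γ) {t : ℝ} {s : ℕ → ℝ}
    (hs : Tendsto s atTop (𝓝[≠] t)) (hne : ∀ n, γ (s n) ≠ γ t) :
    ConvAlong (γ t) (dir (deriv γ t)) (fun n => γ (s n)) :=
  ⟨hne, (h.1.continuous.tendsto t).comp (tendsto_nhds_of_tendsto_nhdsWithin hs),
    (tendsto_secantDir_of_hasDerivAt (h.hasDerivAt t) (h.2.2.2 t)).comp hs⟩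

/-- A sequence on a circle converging to a point of it converges along the tangent. -/
theorem convAlong_of_mem_circle {q u : Plane} (hu : u ≠ 0) {x : ℕ → Plane}
    (hmem : ∀ n, x n ∈ Set.range (circleParam q u)) (hne : ∀ n, x n ≠ q)
    (hx : Tendsto x atTop (𝓝 q)) : ConvAlong q (dir (perp u)) x := by
  refine ⟨hne, hx, tendsto_of_subseq_tendsto fun ns hns => ?_⟩
  obtain ⟨ℓ, ms, hms, hℓ⟩ := CompactSpace.tendsto_subseq fun n => secantDir q (x (ns n))
  obtain ⟨v, hv, rfl⟩ := exists_dir_eq ℓ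
  have hsub := hns.comp hms.tendsto_atTop
  suffices h : dot u v = 0 by
    refine ⟨ms, ?_⟩
    have : dir v = dir (perp u) := by
      rw [eq_comm, dir_eq_dir_iff (perp_ne_zero hu) hv]
      simp only [dot, perp] at h ⊢
      linarith
    exact this ▸ hℓ
  by_contra h
  have hvv := dot_self_pos hv
  set η : ℝ := (dot u v) ^ 2 / (2 * dot v v) with hη
  have hη0 : 0 < η := by positivity
  have hmemU : v ∈ {y : Plane | η * dot y y < dot u y ^ 2} := by
    have h2 : η * dot v v = dot u v ^ 2 / 2 := by
      rw [hη]
      field_simp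
    have : 0 < dot u v ^ 2 := by positivity
    change η * dot v v < dot u v ^ 2
    linarith
  have hev := eventually_mem_of_tendsto_dir (w := fun n => x (ns (ms n)) - q) hv
    (Eventually.of_forall fun n => sub_ne_zero.2 (hne _))
    (hℓ.congr fun n => secantDir_eq_dir _ _) (isOpen_lt (by fun_prop) (by fun_prop))
    (fun y hy a ha => by
      have ha2 : 0 < a ^ 2 := by positivity
      have := mul_lt_mul_of_pos_left (Set.mem_ofPred.1 hy) ha2
      simp only [Set.mem_ofPred_eq, dot, Prod.smul_fst, Prod.smul_snd, smul_eq_mul] at this ⊢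
      linarith) hmemU
  have hlim0 : Tendsto (fun n => dot u (x (ns (ms n)) - q)) atTop (𝓝 0) := by
    have hc : Continuous fun y : Plane => dot u (y - q) := by fun_prop
    have := (hc.tendsto q).comp (hx.comp hsub)
    have h0 : dot u (q - q) = 0 := by simp [dot]
    rwa [h0] at this
  obtain ⟨n, hn, hn'⟩ :=
    (hev.and (hlim0.eventually (gt_mem_nhds (by positivity : (0 : ℝ) < 2 * η)))).exists
  have hcirc := dot_sub_self_of_mem_circle (hmem (ns (ms n)))
  have hpos := dot_self_pos (sub_ne_zero.2 (hne (ns (ms n))))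
  simp only [Set.mem_ofPred_eq] at hn
  nlinarith

theorem interleave_tendsto {X : Type*} {a b : ℕ → X} {F : Filter X} (ha : Tendsto a atTop F)
    (hb : Tendsto b atTop F) :
    Tendsto (fun n => if Even n then a (n / 2) else b (n / 2)) atTop F :=
  have h : Tendsto (· / 2 : ℕ → ℕ) atTop atTop := Nat.tendsto_div_const_atTop two_ne_zero
  (ha.comp h).if' (hb.comp h)

theorem ConvAlong.comp {p : Plane} {ℓ : ProjLine} {x : ℕ → Plane} (h : ConvAlong p ℓ x)
    {s : ℕ → ℕ} (hs : Tendsto s atTop atTop) : ConvAlong p ℓ (x ∘ s) :=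
  ⟨fun _ => h.1 _, h.2.1.comp hs, h.2.2.comp hs⟩

theorem ConvAlong.interleave {p : Plane} {ℓ : ProjLine} {x y : ℕ → Plane} (hx : ConvAlong p ℓ x)
    (hy : ConvAlong p ℓ y) :
    ConvAlong p ℓ (fun n => if Even n then x (n / 2) else y (n / 2)) := by
  refine ⟨fun n => ?_, interleave_tendsto hx.2.1 hy.2.1, ?_⟩
  · beta_reduce
    split_ifs
    exacts [hx.1 _, hy.1 _]
  · simp only [apply_ite (secantDir p)]
    exact interleave_tendsto hx.2.2 hy.2.2

/-- A family of homeomorphisms of tangent directions over `f` that preserves transverse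
sequences. -/
structure TangentMap (f : Plane ≃ₜ Plane) (φ : Plane → (ProjLine ≃ₜ ProjLine)) : Prop where
  induces : ∀ q : Plane, InducesAt ⇑f q (φ q)
  transverse : ∀ (x : ℕ → Plane) (k : ℕ → ProjLine), Transverse x k →
    Transverse (fun n => f (x n)) (fun n => φ (x n) (k n))

theorem ConvAlong.image {f : Plane ≃ₜ Plane} {φ : Plane → (ProjLine ≃ₜ ProjLine)}
    (hf : TangentMap f φ) {q : Plane} {ℓ : ProjLine} {x : ℕ → Plane} (hx : ConvAlong q ℓ x) :
    ConvAlong (f q) (φ q ℓ) (fun n => f (x n)) := by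
  obtain ⟨w, hw, rfl⟩ := exists_dir_eq ℓ
  obtain ⟨u, hu, rfl⟩ : ∃ u, u ≠ 0 ∧ perp u = w :=
    ⟨-perp w, neg_ne_zero.2 (perp_ne_zero hw), by simp [perp]⟩
  obtain ⟨-, δ, s₀, hδ, hrange, hδ₀, htan⟩ := hf.induces q _ _ (tangentAt_circle q hu)
  rw [← dir_of_ne_zero] at htan
  set s : ℕ → ℝ := fun n => s₀ + 1 / (n + 2) with hs
  have hpos : ∀ n : ℕ, (0 : ℝ) < 1 / (n + 2) := fun n => by positivity
  have hlim : Tendsto (fun n : ℕ => (1 : ℝ) / (n + 2)) atTop (𝓝 0) := by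
    have := tendsto_one_div_add_atTop_nhds_zero_nat (𝕜 := ℝ)
    refine ((tendsto_add_atTop_iff_nat 1).2 this).congr fun n => ?_
    push_cast
    ring
  have hs₀ : Tendsto s atTop (𝓝[≠] s₀) := by
    have := hlim.const_add s₀
    rw [add_zero] at this
    refine tendsto_nhdsWithin_iff.2 ⟨this, ?_⟩
    exact Eventually.of_forall fun n => (lt_add_of_pos_right s₀ (hpos n)).ne'
  have hδne : ∀ n, δ (s n) ≠ δ s₀ := fun n => by
    refine (hδ.ne_of_lt (lt_add_of_pos_right s₀ (hpos n)) ?_).symm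
    have : (1 : ℝ) / (n + 2) < 1 := by
      rw [div_lt_one (by positivity)]
      linarith [(Nat.cast_nonneg n : (0 : ℝ) ≤ n)]
    linarith
  have himg := hδ.convAlong hs₀ hδne
  rw [hδ₀, ← htan] at himg
  set r : ℕ → Plane := fun n => f.symm (δ (s n)) with hr
  have hfr : ∀ n, f (r n) = δ (s n) := fun n => f.apply_symm_apply _
  have hrconv : ConvAlong q (dir (perp u)) r := by
    refine convAlong_of_mem_circle hu (fun n => ?_) (fun n h => ?_) ?_
    · have : δ (s n) ∈ f '' Set.range (circleParam q u) := hrange ▸ ⟨s n, rfl⟩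
      obtain ⟨y, hy, hfy⟩ := this
      change f.symm (δ (s n)) ∈ _
      rwa [← hfy, f.symm_apply_apply]
    · exact hδne n (by rw [← hfr, h, hδ₀])
    · have := (f.symm.continuous.tendsto (f q)).comp himg.2.1
      rwa [f.symm_apply_apply] at this
  have hz := hx.interleave hrconv
  set z : ℕ → Plane := fun n => if Even n then x (n / 2) else r (n / 2) with hzdef
  have htz : Transverse z (fun _ => dir u) := by
    refine ⟨q, _, hz, fun ψ _ hlim => dir_perp_ne_dir hu ?_⟩
    exact (tendsto_nhds_unique (tendsto_const_nhds (x := dir u))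
      ((continuous_snd.tendsto _).comp hlim)).symm
  obtain ⟨p, m, hpm, -⟩ := hf.transverse _ _ htz
  have heven : Tendsto (fun n : ℕ => 2 * n) atTop atTop :=
    tendsto_atTop_mono (fun n => by simp only [id_eq]; omega) tendsto_id
  have hodd : Tendsto (fun n : ℕ => 2 * n + 1) atTop atTop :=
    tendsto_atTop_mono (fun n => by simp only [id_eq]; omega) tendsto_id
  have h1 := hpm.comp heven
  have h2 := hpm.comp hodd
  have e1 : (fun n => f (z n)) ∘ (fun n : ℕ => 2 * n) = fun n => f (x n) := by
    ext1 n
    simp [hzdef]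
  have e2 : (fun n => f (z n)) ∘ (fun n : ℕ => 2 * n + 1) = fun n => δ (s n) := by
    ext1 n
    have : (2 * n + 1) / 2 = n := by omega
    simp [hzdef, this, hfr]
  rw [e1] at h1
  rw [e2] at h2
  have hp : p = f q := tendsto_nhds_unique h2.2.1 himg.2.1
  subst hp
  rw [← tendsto_nhds_unique h2.2.2 himg.2.2]
  exact h1

theorem ConvAlong.of_image {f : Plane ≃ₜ Plane} {φ : Plane → (ProjLine ≃ₜ ProjLine)}
    (hf : TangentMap f φ) {q : Plane} {m : ProjLine} {x : ℕ → Plane}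
    (hx : ConvAlong (f q) m (fun n => f (x n))) :
    ConvAlong q ((φ q).symm m) x := by
  have hne : ∀ n, x n ≠ q := fun n h => hx.1 n (congrArg f h)
  have hlim : Tendsto x atTop (𝓝 q) := f.isInducing.tendsto_nhds_iff.2 hx.2.1
  refine ⟨hne, hlim, tendsto_of_subseq_tendsto fun ns hns => ?_⟩
  obtain ⟨ℓ, ms, hms, hℓ⟩ := CompactSpace.tendsto_subseq fun n => secantDir q (x (ns n))
  have hsub := hns.comp hms.tendsto_atTop
  have h1 : ConvAlong q ℓ (x ∘ (ns ∘ ms)) := ⟨fun n => hne _, hlim.comp hsub, hℓ⟩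
  have h2 := tendsto_nhds_unique (h1.image hf).2.2 (hx.comp hsub).2.2
  refine ⟨ms, ?_⟩
  rw [← h2, (φ q).symm_apply_apply]
  exact hℓ

/-- The candidate for the tangent direction of the curve `f.symm ∘ γ` at time `t`. -/
def preimageDir (f : Plane ≃ₜ Plane) (φ : Plane → (ProjLine ≃ₜ ProjLine)) (γ : ℝ → Plane) (t : ℝ) :
    ProjLine :=
  (φ (f.symm (γ t))).symm (dir (deriv γ t))

theorem IsRegParam.tendsto_punctured_of_seq {γ : ℝ → Plane} (hγ : IsRegParam γ) {X : Type*}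
    [TopologicalSpace X] {g : ℝ → X} {t : ℝ} {l : X}
    (h : ∀ s : ℕ → ℝ, Tendsto s atTop (𝓝[≠] t) → (∀ n, γ (s n) ≠ γ t) →
      Tendsto (fun n => g (s n)) atTop (𝓝 l)) :
    Tendsto g (𝓝[≠] t) (𝓝 l) := by
  refine tendsto_of_seq_tendsto fun s hs => ?_
  obtain ⟨N, hN⟩ := eventually_atTop.1 (hs.eventually (hγ.eventually_ne t))
  refine (tendsto_add_atTop_iff_nat N).1 (h (fun n => s (n + N)) ?_ fun n => hN _ (by omega))
  exact (tendsto_add_atTop_iff_nat N).2 hs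

theorem tendsto_secantDir_preimage {f : Plane ≃ₜ Plane} {φ : Plane → (ProjLine ≃ₜ ProjLine)}
    (hf : TangentMap f φ) {γ : ℝ → Plane} (hγ : IsRegParam γ) (t : ℝ) :
    Tendsto (fun s => secantDir (f.symm (γ t)) (f.symm (γ s))) (𝓝[≠] t)
      (𝓝 (preimageDir f φ γ t)) := by
  refine hγ.tendsto_punctured_of_seq fun s hs hne => ?_
  have h := hγ.convAlong hs hne
  refine (ConvAlong.of_image hf (q := f.symm (γ t))
    (x := fun n => f.symm (γ (s n))) ?_).2.2
  simpa only [f.apply_symm_apply] using h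

theorem continuous_preimageDir {f : Plane ≃ₜ Plane} {φ : Plane → (ProjLine ≃ₜ ProjLine)}
    (hf : TangentMap f φ) {γ : ℝ → Plane} (hγ : IsRegParam γ) :
    Continuous (preimageDir f φ γ) := by
  refine continuous_iff_continuousAt.2 fun t => continuousAt_iff_punctured_nhds.2 ?_
  refine hγ.tendsto_punctured_of_seq fun s hs hne => tendsto_of_subseq_tendsto fun ns hns => ?_
  obtain ⟨ℓ, ms, hms, hℓ⟩ := CompactSpace.tendsto_subseq fun n => preimageDir f φ γ (s (ns n))
  refine ⟨ms, ?_⟩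
  suffices h : ℓ = preimageDir f φ γ t by exact h ▸ hℓ
  by_contra hℓt
  have hsub : Tendsto (fun n => s (ns (ms n))) atTop (𝓝[≠] t) :=
    (hs.comp hns).comp hms.tendsto_atTop
  have hconv := hγ.convAlong hsub fun n => hne _
  have hconv' : ConvAlong (f.symm (γ t)) (preimageDir f φ γ t)
      (fun n => f.symm (γ (s (ns (ms n))))) := by
    refine ConvAlong.of_image hf ?_
    simpa only [f.apply_symm_apply] using hconv
  have htr : Transverse (fun n => f.symm (γ (s (ns (ms n)))))
      (fun n => preimageDir f φ γ (s (ns (ms n)))) := by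
    refine ⟨_, _, hconv', fun ψ hψ hlim => hℓt ?_⟩
    exact tendsto_nhds_unique (hℓ.comp hψ.tendsto_atTop) ((continuous_snd.tendsto _).comp hlim)
  obtain ⟨p, m, hpm, hno⟩ := hf.transverse _ _ htr
  simp only [f.apply_symm_apply, preimageDir, Homeomorph.apply_symm_apply] at hpm hno
  obtain rfl := tendsto_nhds_unique hpm.2.1 hconv.2.1
  obtain rfl := tendsto_nhds_unique hpm.2.2 hconv.2.2
  refine hno id strictMono_id (hconv.2.1.prodMk_nhds ?_)
  have hd : Continuous (deriv γ) := hγ.1.continuous_deriv_one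
  exact ((continuousAt_dir (hγ.2.2.2 t)).tendsto.comp (hd.tendsto t)).comp
    (tendsto_nhds_of_tendsto_nhdsWithin hsub)

/-- If two regular curves cross with distinct tangents then there is a local defining function
of the first one that changes sign along the second one. -/
theorem IsRegParam.exists_crossing {γ δ : ℝ → Plane} (hδ : IsRegParam δ) (hγ : IsRegParam γ)
    {s₀ t₀ : ℝ} (heq : δ s₀ = γ t₀) (hdir : dir (deriv δ s₀) ≠ dir (deriv γ t₀)) :
    ∃ (W : Set Plane) (h : Plane → ℝ), IsOpen W ∧ γ t₀ ∈ W ∧ ContinuousOn h W ∧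
      (∀ y ∈ W, h y = 0 → y ∈ Set.range δ) ∧
      ∀ᶠ t in 𝓝 t₀, SignType.sign (h (γ t)) = SignType.sign (t - t₀) := by
  set u := deriv δ s₀ with hu
  set v := deriv γ t₀ with hv
  let L : ℝ × ℝ →L[ℝ] Plane :=
    (ContinuousLinearMap.fst ℝ ℝ ℝ).smulRight u + (ContinuousLinearMap.snd ℝ ℝ ℝ).smulRight v
  have hker : (L : ℝ × ℝ →ₗ[ℝ] Plane).ker = ⊥ := by
    refine LinearMap.ker_eq_bot'.2 fun z hz => ?_
    have hz' : z.1 • u + z.2 • v = 0 := hz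
    rw [Ne, dir_eq_dir_iff (hδ.2.2.2 s₀) (hγ.2.2.2 t₀)] at hdir
    have h1 : z.1 * dot (perp u) v = 0 := by
      have := congrArg (dot (perp v)) hz'
      simp only [dot, perp, Prod.fst_add, Prod.snd_add, Prod.fst_zero, Prod.snd_zero,
        Prod.smul_fst, Prod.smul_snd, smul_eq_mul] at this ⊢
      linarith
    have h2 : z.2 * dot (perp u) v = 0 := by
      have := congrArg (dot (perp u)) hz'
      simp only [dot, perp, Prod.fst_add, Prod.snd_add, Prod.fst_zero, Prod.snd_zero,
        Prod.smul_fst, Prod.smul_snd, smul_eq_mul] at this ⊢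
      linarith
    exact Prod.ext ((mul_eq_zero.1 h1).resolve_right hdir) ((mul_eq_zero.1 h2).resolve_right hdir)
  have hran := LinearMap.ker_eq_bot_iff_range_eq_top.1 hker
  let e := ContinuousLinearEquiv.ofBijective L hker hran
  let F : ℝ × ℝ → Plane := fun z => δ z.1 + z.2 • v
  have hF : HasStrictFDerivAt F (e : ℝ × ℝ →L[ℝ] Plane) (s₀, 0) := by
    have h1 : HasStrictDerivAt δ u s₀ := hδ.1.contDiffAt.hasStrictDerivAt one_ne_zero
    have h2 : HasStrictFDerivAt (fun z : ℝ × ℝ => δ z.1)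
        ((ContinuousLinearMap.fst ℝ ℝ ℝ).smulRight u) (s₀, 0) := by
      have h3 := HasStrictFDerivAt.comp (g := δ) (f := Prod.fst) ((s₀, 0) : ℝ × ℝ)
        h1.hasStrictFDerivAt hasStrictFDerivAt_fst
      convert! h3 using 1
    have h3 : HasStrictFDerivAt (fun z : ℝ × ℝ => z.2 • v)
        ((ContinuousLinearMap.snd ℝ ℝ ℝ).smulRight v) (s₀, 0) :=
      ((ContinuousLinearMap.snd ℝ ℝ ℝ).smulRight v).hasStrictFDerivAt
    exact h2.add h3
  have hF0 : F (s₀, 0) = γ t₀ := by simp [F, heq]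
  let E := hF.toOpenPartialHomeomorph F
  refine ⟨E.target, fun y => (E.symm y).2, E.open_target,
    hF0 ▸ hF.image_mem_toOpenPartialHomeomorph_target,
    continuous_snd.comp_continuousOn E.continuousOn_symm, fun y hy h0 => ?_, ?_⟩
  · have h1 : δ (E.symm y).1 + (E.symm y).2 • v = y := E.right_inv hy
    have h2 : (E.symm y).2 = 0 := h0
    rw [h2, zero_smul, add_zero] at h1
    exact ⟨_, h1⟩
  · have h1 : HasFDerivAt E.symm (e.symm : Plane →L[ℝ] ℝ × ℝ) (γ t₀) :=
      hF0 ▸ hF.to_localInverse.hasFDerivAt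
    have h2 : HasDerivAt (fun t => (E.symm (γ t)).2) (e.symm v).2 t₀ :=
      (ContinuousLinearMap.snd ℝ ℝ ℝ).hasFDerivAt.comp_hasDerivAt t₀
        (h1.comp_hasDerivAt t₀ (hγ.hasDerivAt t₀))
    have h3 : e.symm v = (0, 1) := by
      rw [e.symm_apply_eq]
      change v = (0 : ℝ) • u + (1 : ℝ) • v
      simp
    have h4 : E.symm (γ t₀) = (s₀, 0) := by
      rw [← hF0]
      exact E.left_inv hF.mem_toOpenPartialHomeomorph_source
    refine eventually_nhdsWithin_sign_eq_of_deriv_pos (f := fun t => (E.symm (γ t)).2) ?_ ?_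
    · rw [h2.deriv, h3]
      exact one_pos
    · simp [h4]

/-- The open disc bounded by `circleParam q u`. -/
def openDisc (q u : Plane) : Set Plane := {y | dot (y - q) (y - q) < 2 * dot u (y - q)}

theorem convex_openDisc (q u : Plane) : Convex ℝ (openDisc q u) := by
  intro x hx y hy a b ha hb hab
  have h1 : a • x + b • y - q = a • (x - q) + b • (y - q) := by
    have : a • x + b • y - q = a • x + b • y - (a + b) • q := by rw [hab, one_smul]
    rw [this]
    module
  have hx' : 0 < 2 * dot u (x - q) - dot (x - q) (x - q) := sub_pos.2 hx
  have hy' : 0 < 2 * dot u (y - q) - dot (y - q) (y - q) := sub_pos.2 hy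
  change dot _ _ < 2 * dot u _
  rw [h1]
  generalize x - q = X at *
  generalize y - q = Y at *
  have h2 : 0 ≤ a * b * dot (X - Y) (X - Y) :=
    mul_nonneg (mul_nonneg ha hb) (add_nonneg (mul_self_nonneg _) (mul_self_nonneg _))
  have h3 : 0 < a * (2 * dot u X - dot X X) + b * (2 * dot u Y - dot Y Y) := by
    rcases ha.eq_or_lt with rfl | ha
    · rw [zero_add] at hab
      simpa [hab] using hy'
    · exact add_pos_of_pos_of_nonneg (mul_pos ha hx') (mul_nonneg hb hy'.le)
  have h4 : 2 * dot u (a • X + b • Y) - dot (a • X + b • Y) (a • X + b • Y)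
      = a * (2 * dot u X - dot X X) + b * (2 * dot u Y - dot Y Y)
        + a * b * dot (X - Y) (X - Y) := by
    obtain rfl : b = 1 - a := by linarith
    simp only [dot, Prod.fst_add, Prod.snd_add, Prod.fst_sub, Prod.snd_sub, Prod.smul_fst,
      Prod.smul_snd, smul_eq_mul]
    ring
  linarith

/-- The curve `f.symm ∘ γ` does not stay, both shortly before and shortly after `t₀`, inside a disc
whose boundary circle it meets orthogonally at time `t₀`. -/
theorem not_eventually_mem_openDisc {f : Plane ≃ₜ Plane} {φ : Plane → (ProjLine ≃ₜ ProjLine)}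
    (hf : TangentMap f φ) {γ : ℝ → Plane} (hγ : IsRegParam γ) {t₀ : ℝ} {v : Plane} (hv : v ≠ 0)
    (hdir : dir v = preimageDir f φ γ t₀) :
    ¬ ∀ᶠ t in 𝓝[≠] t₀, f.symm (γ t) ∈ openDisc (f.symm (γ t₀)) v := by
  intro hev
  set q := f.symm (γ t₀) with hq
  have hfq : f q = γ t₀ := f.apply_symm_apply _
  obtain ⟨-, δ, s₀, hδ, hrange, hδ₀, htan⟩ := hf.induces q _ _ (tangentAt_circle q hv)
  rw [← dir_of_ne_zero] at htan
  have hφv : φ q (dir v) = dir (deriv γ t₀) := by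
    rw [hdir, preimageDir, Homeomorph.apply_symm_apply]
  obtain ⟨W, h, hW, hmem, hcont, hzero, hsign⟩ := hδ.exists_crossing hγ (hδ₀.trans hfq) (by
    rw [← htan, ← hφv]
    exact fun h => dir_perp_ne_dir hv ((φ q).injective h))
  obtain ⟨r, hr, hball⟩ := Metric.isOpen_iff.1 (hW.preimage f.continuous) q (by
    rwa [Set.mem_preimage, hfq])
  set S := Metric.ball q r ∩ openDisc q v with hS
  have hpre : IsPreconnected S := ((convex_ball q r).inter (convex_openDisc q v)).isPreconnected
  have hcontS : ContinuousOn (fun y => h (f y)) S :=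
    hcont.comp f.continuous.continuousOn fun y hy => hball hy.1
  have hc : Tendsto (fun t => f.symm (γ t)) (𝓝[≠] t₀) (𝓝 q) :=
    ((f.symm.continuous.comp hγ.1.continuous).tendsto t₀).mono_left nhdsWithin_le_nhds
  have hall : ∀ᶠ t in 𝓝[≠] t₀, f.symm (γ t) ∈ S ∧
      SignType.sign (h (γ t)) = SignType.sign (t - t₀) :=
    ((hc.eventually (Metric.ball_mem_nhds q hr)).and hev).and (hsign.filter_mono nhdsWithin_le_nhds)
  obtain ⟨t₁, ⟨h1S, h1s⟩, h1⟩ := ((hall.filter_mono (nhdsLT_le_nhdsNE t₀)).and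
    (self_mem_nhdsWithin (s := Set.Iio t₀))).exists
  obtain ⟨t₂, ⟨h2S, h2s⟩, h2⟩ := ((hall.filter_mono (nhdsGT_le_nhdsNE t₀)).and
    (self_mem_nhdsWithin (s := Set.Ioi t₀))).exists
  rw [sign_neg (sub_neg.2 h1), sign_eq_neg_one_iff] at h1s
  rw [sign_pos (sub_pos.2 h2), sign_eq_one_iff] at h2s
  obtain ⟨y, hyS, hy⟩ := hpre.intermediate_value₂ h1S h2S hcontS continuousOn_const
    (g := fun _ => (0 : ℝ)) (by simpa using h1s.le) (by simpa using h2s.le)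
  have hy' : f y ∈ f '' Set.range (circleParam q v) := hrange ▸ hzero _ (hball hyS.1) hy
  rw [f.injective.mem_set_image] at hy'
  exact hyS.2.ne (dot_sub_self_of_mem_circle hy')

theorem not_isLocalMin_dot_preimage {f : Plane ≃ₜ Plane} {φ : Plane → (ProjLine ≃ₜ ProjLine)}
    (hf : TangentMap f φ) {γ : ℝ → Plane} (hγ : IsRegParam γ) {t₀ : ℝ} {a v : Plane} (hv : v ≠ 0)
    (hdir : dir v = preimageDir f φ γ t₀) (hav : 0 < dot a v) :
    ¬ IsLocalMin (fun t => dot a (f.symm (γ t))) t₀ := by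
  intro hmin
  refine not_eventually_mem_openDisc hf hγ hv hdir ?_
  have hvv := dot_self_pos hv
  have hlim := tendsto_secantDir_preimage hf hγ t₀
  rw [← hdir] at hlim
  simp only [secantDir_eq_dir] at hlim
  have hne : ∀ᶠ t in 𝓝[≠] t₀, f.symm (γ t) - f.symm (γ t₀) ≠ 0 := by
    filter_upwards [hγ.eventually_ne t₀] with t ht
    exact sub_ne_zero.2 fun h => ht (f.symm.injective h)
  have hU := eventually_mem_of_tendsto_dir hv hne hlim
    (U := {w | dot (perp v) w ^ 2 < dot v w ^ 2} ∩ {w | 0 < dot a w * dot v w})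
    ((isOpen_lt (by fun_prop) (by fun_prop)).inter (isOpen_lt (by fun_prop) (by fun_prop)))
    (fun w hw b hb => by
      have hb2 : 0 < b ^ 2 := by positivity
      have h1 := mul_lt_mul_of_pos_left hw.1 hb2
      have h2 := mul_pos hb2 hw.2
      simp only [Set.mem_inter_iff, Set.mem_ofPred_eq, dot_smul]
      constructor <;> linarith)
    ⟨by
      have : dot (perp v) v = 0 := by simp only [dot, perp]; ring
      change dot (perp v) v ^ 2 < dot v v ^ 2
      rw [this, zero_pow two_ne_zero]
      positivity, mul_pos hav hvv⟩
  have hlim0 : Tendsto (fun t => dot v (f.symm (γ t) - f.symm (γ t₀))) (𝓝[≠] t₀) (𝓝 0) := by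
    have hc : Continuous fun t => dot v (f.symm (γ t) - f.symm (γ t₀)) := by
      have := f.symm.continuous.comp hγ.1.continuous
      fun_prop
    have := hc.tendsto t₀
    simp only [sub_self] at this
    have h0 : dot v 0 = 0 := by simp [dot]
    rw [h0] at this
    exact this.mono_left nhdsWithin_le_nhds
  filter_upwards [hU, hlim0.eventually (gt_mem_nhds hvv), nhdsWithin_le_nhds hmin]
    with t ⟨h1, h2⟩ h3 h4
  change dot _ _ < 2 * dot v _
  have h5 : 0 ≤ dot a (f.symm (γ t) - f.symm (γ t₀)) := by
    simp only [dot, Prod.fst_sub, Prod.snd_sub] at h4 ⊢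
    linarith
  generalize f.symm (γ t) - f.symm (γ t₀) = w at *
  have h6 : 0 < dot v w := by
    by_contra! h
    exact absurd h2 (not_lt.2 (mul_nonpos_of_nonneg_of_nonpos h5 h))
  have h7 : dot w w * dot v v = dot v w ^ 2 + dot (perp v) w ^ 2 := by
    simp only [dot, perp]
    ring
  have h8 : dot v w * dot v w < dot v w * dot v v := mul_lt_mul_of_pos_left h3 h6
  refine lt_of_mul_lt_mul_right ?_ hvv.le
  simp only [Set.mem_ofPred_eq] at h1
  linarith

theorem not_isLocalExtr_dot_preimage {f : Plane ≃ₜ Plane} {φ : Plane → (ProjLine ≃ₜ ProjLine)}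
    (hf : TangentMap f φ) {γ : ℝ → Plane} (hγ : IsRegParam γ) {t₀ : ℝ} {a v : Plane} (hv : v ≠ 0)
    (hdir : dir v = preimageDir f φ γ t₀) (hav : dot a v ≠ 0) :
    ¬ IsLocalExtr (fun t => dot a (f.symm (γ t))) t₀ := by
  have hmin : ∀ b, dot b v ≠ 0 → ¬ IsLocalMin (fun t => dot b (f.symm (γ t))) t₀ := by
    intro b hb
    rcases lt_or_gt_of_ne hb with h | h
    · refine not_isLocalMin_dot_preimage hf hγ (neg_ne_zero.2 hv) ?_ ?_
      · rw [← hdir, ← neg_one_smul ℝ v, dir_smul (by norm_num) hv]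
      · rw [← neg_one_smul ℝ v, dot_smul]
        linarith
    · exact not_isLocalMin_dot_preimage hf hγ hv hdir h
  rintro (h | h)
  · exact hmin a hav h
  · have hneg : ∀ w, dot (-a) w = -dot a w := fun w => by
      simp only [dot, Prod.fst_neg, Prod.snd_neg]
      ring
    refine hmin (-a) (by rw [hneg]; exact neg_ne_zero.2 hav) ?_
    simp only [hneg]
    exact h.neg

theorem exists_strictMonoOn_or_strictAntiOn_of_not_isLocalExtr {g : ℝ → ℝ} (hg : Continuous g)
    {t₀ : ℝ} (h : ∀ᶠ t in 𝓝 t₀, ¬ IsLocalExtr g t) :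
    ∃ δ > 0, StrictMonoOn g (Set.Icc (t₀ - δ) (t₀ + δ)) ∨
      StrictAntiOn g (Set.Icc (t₀ - δ) (t₀ + δ)) := by
  obtain ⟨δ, hδ, hball⟩ := Metric.nhds_basis_closedBall.eventually_iff.1 h
  rw [Real.closedBall_eq_Icc] at hball
  refine ⟨δ, hδ, hg.continuousOn.strictMonoOn_of_injOn_Icc' (by linarith) ?_⟩
  intro s hs t ht hst
  by_contra hne
  wlog hlt : s < t generalizing s t
  · exact this ht hs hst.symm (Ne.symm hne) (lt_of_le_of_ne (not_lt.1 hlt) (Ne.symm hne))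
  obtain ⟨r, hr, hext⟩ := exists_isLocalExtr_Ioo hlt hg.continuousOn hst
  exact hball ⟨hs.1.trans hr.1.le, hr.2.le.trans ht.2⟩ hext

theorem exists_strictMonoOn_or_strictAntiOn_preimage {f : Plane ≃ₜ Plane}
    {φ : Plane → (ProjLine ≃ₜ ProjLine)} (hf : TangentMap f φ) {γ : ℝ → Plane} (hγ : IsRegParam γ)
    {t₀ : ℝ} {a v : Plane} (hv : v ≠ 0) (hdir : dir v = preimageDir f φ γ t₀)
    (hav : dot a v ≠ 0) :
    ∃ δ > 0, StrictMonoOn (fun t => dot a (f.symm (γ t))) (Set.Icc (t₀ - δ) (t₀ + δ)) ∨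
      StrictAntiOn (fun t => dot a (f.symm (γ t))) (Set.Icc (t₀ - δ) (t₀ + δ)) := by
  have hc := f.symm.continuous.comp hγ.1.continuous
  refine exists_strictMonoOn_or_strictAntiOn_of_not_isLocalExtr (by fun_prop) ?_
  choose w hw hwdir using fun t => exists_dir_eq (preimageDir f φ γ t)
  have hlim := (continuous_preimageDir hf hγ).tendsto t₀
  rw [← hdir, ← funext hwdir] at hlim
  have hU := eventually_mem_of_tendsto_dir (U := {x | dot a x ≠ 0}) hv (Eventually.of_forall hw)
    hlim (isOpen_ne_fun (by fun_prop) (by fun_prop)) (fun x hx b hb => by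
      simpa only [Set.mem_ofPred_eq, dot_smul] using mul_ne_zero hb hx) hav
  filter_upwards [hU] with t ht
  exact not_isLocalExtr_dot_preimage hf hγ (hw t) (hwdir t) ht

theorem exists_strictMonoOn_preimage {f : Plane ≃ₜ Plane}
    {φ : Plane → (ProjLine ≃ₜ ProjLine)} (hf : TangentMap f φ) {γ : ℝ → Plane} (hγ : IsRegParam γ)
    {t₀ : ℝ} {a v : Plane} (hv : v ≠ 0) (hdir : dir v = preimageDir f φ γ t₀) {δ : ℝ} (hδ : 0 < δ)
    (hmono : StrictMonoOn (fun t => dot v (f.symm (γ t))) (Set.Icc (t₀ - δ) (t₀ + δ)))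
    (hav : 0 < dot a v) :
    ∃ δ > 0, StrictMonoOn (fun t => dot a (f.symm (γ t))) (Set.Icc (t₀ - δ) (t₀ + δ)) := by
  obtain ⟨ε, hε, h | h⟩ := exists_strictMonoOn_or_strictAntiOn_preimage hf hγ hv hdir hav.ne'
  · exact ⟨ε, hε, h⟩
  exfalso
  have hlim := tendsto_secantDir_preimage hf hγ t₀
  rw [← hdir] at hlim
  simp only [secantDir_eq_dir] at hlim
  have hne : ∀ᶠ t in 𝓝[≠] t₀, f.symm (γ t) - f.symm (γ t₀) ≠ 0 := by
    filter_upwards [hγ.eventually_ne t₀] with t ht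
    exact sub_ne_zero.2 fun h => ht (f.symm.injective h)
  have hU := eventually_mem_of_tendsto_dir hv hne hlim
    (U := {w | 0 < dot a w * dot v w}) (isOpen_lt (by fun_prop) (by fun_prop))
    (fun w hw b hb => by
      have hb2 : 0 < b ^ 2 := by positivity
      have h2 := mul_pos hb2 hw
      simp only [Set.mem_ofPred_eq, dot_smul]
      linarith) (mul_pos hav (dot_self_pos hv))
  obtain ⟨t, ht, ht', ht''⟩ := ((hU.filter_mono (nhdsGT_le_nhdsNE t₀)).and
    (Ioo_mem_nhdsGT (show t₀ < t₀ + min δ ε by linarith [lt_min hδ hε]))).exists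
  have h1 : t₀ < t := ht'
  have h2 : t < t₀ + min δ ε := ht''
  have hv' := hmono ⟨by linarith, by linarith⟩ ⟨by linarith, by linarith [min_le_left δ ε]⟩ h1
  have ha' := h ⟨by linarith, by linarith⟩ ⟨by linarith, by linarith [min_le_right δ ε]⟩ h1
  simp only [Set.mem_ofPred_eq] at ht
  have e1 : ∀ b, dot b (f.symm (γ t) - f.symm (γ t₀))
      = dot b (f.symm (γ t)) - dot b (f.symm (γ t₀)) := fun b => by
    simp only [dot, Prod.fst_sub, Prod.snd_sub]
    ring
  rw [e1, e1] at ht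
  exact absurd ht (not_lt.2 (mul_nonpos_of_nonpos_of_nonneg (by simpa using ha'.le)
    (by simpa using hv'.le)))

/-- A vector making a small angle with the unit vector `v` is close to its length times `v`. -/
theorem norm_sub_norm_smul_le {v w : Plane} (hv : ‖v‖ = 1) {η : ℝ} (hη : 0 < η)
    (hle : |dot (perp v) w| ≤ η * dot v w) :
    ‖w - ‖w‖ • v‖ ≤ 4 * η * ‖w‖ := by
  have hv1 : |v.1| ≤ 1 := hv ▸ norm_fst_le v
  have hv2 : |v.2| ≤ 1 := hv ▸ norm_snd_le v
  have hw1 : |w.1| ≤ ‖w‖ := norm_fst_le w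
  have hw2 : |w.2| ≤ ‖w‖ := norm_snd_le w
  have hperp : ‖perp v‖ = 1 := by
    rw [← hv]
    simp only [Prod.norm_def, perp, norm_neg, max_comm]
  set N := dot v v with hN
  have hN1 : 1 ≤ N := by
    rw [Prod.norm_def, Real.norm_eq_abs, Real.norm_eq_abs] at hv
    rcases max_choice |v.1| |v.2| with h | h
    · have h1 : |v.1| = 1 := h.symm.trans hv
      have h2 : v.1 * v.1 = 1 := by rw [← abs_mul_abs_self, h1, one_mul]
      have : N = v.1 * v.1 + v.2 * v.2 := rfl
      nlinarith [mul_self_nonneg v.2]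
    · have h1 : |v.2| = 1 := h.symm.trans hv
      have h2 : v.2 * v.2 = 1 := by rw [← abs_mul_abs_self, h1, one_mul]
      have : N = v.1 * v.1 + v.2 * v.2 := rfl
      nlinarith [mul_self_nonneg v.1]
  have hA : |dot v w| ≤ 2 * ‖w‖ := by
    calc |dot v w| ≤ |v.1 * w.1| + |v.2 * w.2| := abs_add_le _ _
      _ = |v.1| * |w.1| + |v.2| * |w.2| := by rw [abs_mul, abs_mul]
      _ ≤ 1 * ‖w‖ + 1 * ‖w‖ := by gcongr
      _ = 2 * ‖w‖ := by ring
  have hdecomp : N • w - dot v w • v = dot (perp v) w • perp v := by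
    ext <;> simp only [hN, dot, perp, Prod.fst_sub, Prod.snd_sub, Prod.smul_fst, Prod.smul_snd,
      smul_eq_mul] <;> ring
  have h1 : ‖N • w - dot v w • v‖ ≤ η * dot v w := by
    rw [hdecomp, norm_smul, hperp, mul_one]
    exact hle
  have hA0 : 0 ≤ dot v w := nonneg_of_mul_nonneg_right ((abs_nonneg _).trans hle) hη
  have hN0 : 0 ≤ N := zero_le_one.trans hN1
  have h2 : |dot v w - N * ‖w‖| ≤ η * dot v w := by
    have := abs_norm_sub_norm_le (dot v w • v) (N • w)
    rw [norm_smul, norm_smul, hv, mul_one, Real.norm_of_nonneg hA0, Real.norm_of_nonneg hN0,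
      norm_sub_rev] at this
    exact this.trans h1
  have h3 : N * ‖w - ‖w‖ • v‖ ≤ 4 * η * ‖w‖ := by
    calc N * ‖w - ‖w‖ • v‖ = ‖N • (w - ‖w‖ • v)‖ := by rw [norm_smul, Real.norm_of_nonneg hN0]
      _ = ‖(N • w - dot v w • v) + (dot v w - N * ‖w‖) • v‖ := by
        congr 1
        module
      _ ≤ ‖N • w - dot v w • v‖ + |dot v w - N * ‖w‖| := by
        refine (norm_add_le _ _).trans_eq ?_
        rw [norm_smul, hv, mul_one, Real.norm_eq_abs]
      _ ≤ η * dot v w + η * dot v w := add_le_add h1 h2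
      _ ≤ 4 * η * ‖w‖ := by nlinarith [le_abs_self (dot v w)]
  exact (le_mul_of_one_le_left (norm_nonneg _) hN1).trans h3

theorem exists_hasDirection_preimage {f : Plane ≃ₜ Plane} {φ : Plane → (ProjLine ≃ₜ ProjLine)}
    (hf : TangentMap f φ) {γ : ℝ → Plane} (hγ : IsRegParam γ) (t₀ : ℝ) :
    ∃ v, HasDirection (fun t => f.symm (γ t)) t₀ v := by
  obtain ⟨v, hv, hdir, δ, hδ, hmono⟩ : ∃ v : Plane, ‖v‖ = 1 ∧ dir v = preimageDir f φ γ t₀ ∧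
      ∃ δ > 0, StrictMonoOn (fun t => dot v (f.symm (γ t))) (Set.Icc (t₀ - δ) (t₀ + δ)) := by
    obtain ⟨u, hu, hdir⟩ := exists_dir_eq (preimageDir f φ γ t₀)
    have hn : ‖u‖ ≠ 0 := norm_ne_zero_iff.2 hu
    have hv : ‖‖u‖⁻¹ • u‖ = 1 := by simp [norm_smul, hn]
    rw [← dir_smul (inv_ne_zero hn) hu] at hdir
    generalize ‖u‖⁻¹ • u = v at *
    have hv0 : v ≠ 0 := norm_ne_zero_iff.1 (hv ▸ one_ne_zero)
    obtain ⟨δ, hδ, h | h⟩ := exists_strictMonoOn_or_strictAntiOn_preimage hf hγ hv0 hdir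
      (dot_self_pos hv0).ne'
    · exact ⟨v, hv, hdir, δ, hδ, h⟩
    · refine ⟨-v, by rwa [norm_neg], ?_, δ, hδ, ?_⟩
      · rw [← hdir, ← neg_one_smul ℝ v, dir_smul (by norm_num) hv0]
      · convert! h.neg using 2
        simp only [dot, Prod.fst_neg, Prod.snd_neg]
        ring
  have hv0 : v ≠ 0 := norm_ne_zero_iff.1 (hv ▸ one_ne_zero)
  have hvv := dot_self_pos hv0
  refine ⟨v, hv, fun ε hε => ?_⟩
  have hη : 0 < ε / 4 := by positivity
  have hpos : ∀ σ : ℝ, 0 < dot ((ε / 4) • v + σ • perp v) v := fun σ => by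
    have : dot ((ε / 4) • v + σ • perp v) v = ε / 4 * dot v v := by
      simp only [dot, perp, Prod.fst_add, Prod.snd_add, Prod.smul_fst, Prod.smul_snd, smul_eq_mul]
      ring
    rw [this]
    positivity
  obtain ⟨δ₁, hδ₁, h₁⟩ := exists_strictMonoOn_preimage hf hγ hv0 hdir hδ hmono (hpos 1)
  obtain ⟨δ₂, hδ₂, h₂⟩ := exists_strictMonoOn_preimage hf hγ hv0 hdir hδ hmono (hpos (-1))
  refine ⟨min δ₁ δ₂, lt_min hδ₁ hδ₂, fun s hs t ht hst => ?_⟩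
  have hl := min_le_left δ₁ δ₂
  have hr := min_le_right δ₁ δ₂
  have k₁ := h₁.monotoneOn ⟨by linarith [hs.1], by linarith [hs.2]⟩
    ⟨by linarith [ht.1], by linarith [ht.2]⟩ hst
  have k₂ := h₂.monotoneOn ⟨by linarith [hs.1], by linarith [hs.2]⟩
    ⟨by linarith [ht.1], by linarith [ht.2]⟩ hst
  have := norm_sub_norm_smul_le (w := f.symm (γ t) - f.symm (γ s)) hv hη (by
    simp only [dot, perp, Prod.fst_add, Prod.snd_add, Prod.fst_sub, Prod.snd_sub, Prod.smul_fst,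
      Prod.smul_snd, smul_eq_mul] at k₁ k₂ ⊢
    rw [abs_le]
    constructor <;> linarith)
  rwa [mul_div_cancel₀ ε four_ne_zero] at this

theorem mapsC1_symm {f : Plane ≃ₜ Plane} {φ : Plane → (ProjLine ≃ₜ ProjLine)}
    (hf : TangentMap f φ) : MapsC1 ⇑f.symm := by
  rintro _ ⟨γ, hγ, rfl⟩
  obtain ⟨c, hc, hper, hinj, hderiv, hrange⟩ := exists_contDiff_reparam
    (c := fun t => f.symm (γ t)) (f.symm.continuous.comp hγ.1.continuous)
    (fun t => congrArg f.symm (hγ.2.1 t))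
    (fun s t hst hts h => hγ.ne_of_lt hst hts (f.symm.injective h))
    (exists_hasDirection_preimage hf hγ)
  exact ⟨c, ⟨hc, hper, hinj, hderiv⟩, by rw [hrange, ← Set.range_comp, Function.comp_def]⟩

/-- Sufficiency: a homeomorphism with properties (a), (b), (c) has an inverse that also
maps every C¹ curve to a C¹ curve, hence lies in `Homeo¹(ℝ²)`. -/
theorem inverse_maps_c1 (f : Plane ≃ₜ Plane)
    (hmaps : MapsC1 ⇑f)
    (φ : Plane → (ProjLine ≃ₜ ProjLine)) (hφ : ∀ q : Plane, InducesAt ⇑f q (φ q))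
    (htrans : ∀ (x : ℕ → Plane) (k : ℕ → ProjLine), Transverse x k →
      Transverse (fun n => f (x n)) (fun n => φ (x n) (k n))) :
    MapsC1 ⇑f.symm ∧ InHomeo1 f := by
  have := mapsC1_symm ⟨hφ, htrans⟩
  exact ⟨this, hmaps, this⟩
end
end

section
/- There exists a homeomorphism f of ℝ² with f(0) = 0 such that: f ∈ Homeo¹(ℝ²); f is not differentiable at 0; and the induced map on the projective tangent space at the origin is the identity, i.e. for every simple closed C¹ curve Γ through 0 with tangent line ℓ at 0, the curve f(Γ) has tangent line ℓ at 0. In particular the group of C¹ diffeomorphisms of ℝ² is a proper subgroup of Homeo¹(ℝ²). -/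
open Filter Topology

noncomputable section

/-- A continuous function with derivative `g` off a countable set, where `g` is continuous, has
derivative `g` everywhere. -/
theorem hasDerivAt_of_hasDerivAt_off_countable {f g : ℝ → Plane} {s : Set ℝ} (hs : s.Countable)
    (hf : Continuous f) (hg : Continuous g) (hd : ∀ x, x ∉ s → HasDerivAt f (g x) x) (x : ℝ) :
    HasDerivAt f (g x) x := by
  have hint : ∀ u, f u = f x + ∫ t in x..u, g t := fun u => by
    rw [MeasureTheory.integral_eq_of_hasDerivAt_off_countable f g hs hf.continuousOn
      (fun t ht => hd t ht.2) (hg.intervalIntegrable _ _)]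
    abel
  rw [funext hint]
  exact (intervalIntegral.integral_hasDerivAt_right (hg.intervalIntegrable _ _)
    (hg.stronglyMeasurableAtFilter _ _) hg.continuousAt).const_add _

/-- The speed `w` of a closed curve with continuous direction field `n` is integrable across an
isolated singularity. -/
theorem intervalIntegrable_speed {β n : ℝ → Plane} {w : ℝ → ℝ} (hβ : Continuous β)
    (hn : Continuous n) (hn0 : n 0 ≠ 0) (hwper : Function.Periodic w 1) (hw : ∀ t, 0 < w t)
    (hwc : ContinuousOn w (Set.range ((↑) : ℤ → ℝ))ᶜ)
    (hd : ∀ t, t ∉ Set.range ((↑) : ℤ → ℝ) → HasDerivAt β (w t • n t) t) (a b : ℝ) :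
    IntervalIntegrable w MeasureTheory.volume a b := by
  have hnon : ∀ (k : ℤ) (t : ℝ), (k : ℝ) < t → t < k + 1 → t ∉ Set.range ((↑) : ℤ → ℝ) := by
    rintro k t h1 h2 ⟨m, rfl⟩
    norm_cast at h1 h2
    lia
  obtain ⟨φ, hφ⟩ := SeparatingDual.exists_eq_one (R := ℝ) hn0
  have hφc : Continuous fun t => φ (n t) := φ.continuous.comp hn
  have hev : ∀ᶠ t in 𝓝 (0 : ℝ), 0 < φ (n t) :=
    hφc.continuousAt.eventually (lt_mem_nhds (by simp [hφ]))
  obtain ⟨ε', hε', hball⟩ := Metric.eventually_nhds_iff.1 hev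
  obtain ⟨ε, hε, hε2, hε1⟩ : ∃ ε : ℝ, 0 < ε ∧ ε < ε' ∧ ε < 1 / 2 :=
    ⟨min ε' (1 / 2) / 2, by positivity,
      by linarith [min_le_left ε' (1 / 2), lt_min hε' one_half_pos],
      by linarith [min_le_right ε' (1 / 2), lt_min hε' one_half_pos]⟩
  have hpos : ∀ t ∈ Set.Icc (-ε) ε, 0 < φ (n t) := fun t ht =>
    hball (by rw [Real.dist_eq, sub_zero]; exact (abs_le.2 ht).trans_lt hε2)
  have key : ∀ c d : ℝ, c ≤ d → -ε ≤ c → d ≤ ε →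
      (∀ t ∈ Set.Ioo c d, t ∉ Set.range ((↑) : ℤ → ℝ)) →
      IntervalIntegrable w MeasureTheory.volume c d := by
    intro c d hcd hc hd' hmem
    have hsub : Set.uIcc c d ⊆ Set.Icc (-ε) ε := by
      rw [Set.uIcc_of_le hcd]
      exact Set.Icc_subset_Icc hc hd'
    have h1 : IntervalIntegrable (fun t => w t * φ (n t)) MeasureTheory.volume c d := by
      refine intervalIntegral.intervalIntegrable_deriv_of_nonneg (g := fun t => φ (β t))
        (φ.continuous.comp hβ).continuousOn ?_ ?_
      · intro t ht
        rw [min_eq_left hcd, max_eq_right hcd] at ht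
        have := φ.hasFDerivAt.comp_hasDerivAt t (hd t (hmem t ht))
        rw [map_smul] at this
        exact this
      · intro t ht
        rw [min_eq_left hcd, max_eq_right hcd] at ht
        exact mul_nonneg (hw t).le (hpos t ⟨by linarith [ht.1], by linarith [ht.2]⟩).le
    have h2 : ContinuousOn (fun t => (φ (n t))⁻¹) (Set.uIcc c d) :=
      hφc.continuousOn.inv₀ fun t ht => (hpos t (hsub ht)).ne'
    refine (h1.mul_continuousOn h2).congr_ae ?_
    refine (MeasureTheory.ae_restrict_iff' measurableSet_uIoc).2 (.of_forall fun t ht => ?_)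
    have := (hpos t (hsub (Set.uIoc_subset_uIcc ht))).ne'
    field_simp
  have i1 := key (-ε) 0 (by linarith) le_rfl hε.le fun t ht => hnon (-1) t
    (by push_cast; linarith [ht.1]) (by push_cast; linarith [ht.2])
  have i2 := key 0 ε hε.le (by linarith) le_rfl fun t ht => hnon 0 t
    (by push_cast; linarith [ht.1]) (by push_cast; linarith [ht.2])
  have i3 : IntervalIntegrable w MeasureTheory.volume ε (-ε + 1) := by
    refine (hwc.mono fun t ht => ?_).intervalIntegrable
    rw [Set.uIcc_of_le (by linarith)] at ht
    exact hnon 0 t (by push_cast; linarith [ht.1]) (by push_cast; linarith [ht.2])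
  exact hwper.intervalIntegrable one_ne_zero ((i1.trans i2).trans i3) a b

/-- A closed curve whose velocity is a positive function times a continuous nonvanishing direction
field, off the integers, becomes regular after a reparameterization. -/
theorem exists_isRegParam_of_direction {β n : ℝ → Plane} {w : ℝ → ℝ} (hβ : Continuous β)
    (hβper : Function.Periodic β 1) (hβinj : Set.InjOn β (Set.Ico 0 1))
    (hn : Continuous n) (hn0 : ∀ t, n t ≠ 0) (hwper : Function.Periodic w 1) (hw : ∀ t, 0 < w t)
    (hwc : ContinuousOn w (Set.range ((↑) : ℤ → ℝ))ᶜ)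
    (hd : ∀ t, t ∉ Set.range ((↑) : ℤ → ℝ) → HasDerivAt β (w t • n t) t) :
    ∃ δ : ℝ → Plane, IsRegParam δ ∧ Set.range δ = Set.range β ∧ δ 0 = β 0 ∧
      ∃ c : ℝ, c ≠ 0 ∧ deriv δ 0 = c • n 0 := by
  have hint := intervalIntegrable_speed hβ hn (hn0 0) hwper hw hwc hd
  set T : ℝ := ∫ t in (0 : ℝ)..1, w t with hT
  have hTpos : 0 < T := intervalIntegral.intervalIntegral_pos_of_pos (hint 0 1) hw one_pos
  let Θ : ℝ → ℝ := fun x => ∫ t in (0 : ℝ)..x, w t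
  have hΘc : Continuous Θ := intervalIntegral.continuous_primitive hint 0
  have hΘmono : StrictMono Θ := fun a b hab => by
    have := intervalIntegral.intervalIntegral_pos_of_pos (hint a b) hw hab
    rw [← intervalIntegral.integral_interval_sub_left (hint 0 b) (hint 0 a)] at this
    exact sub_pos.1 this
  have hΘsurj : Function.Surjective Θ := hΘc.surjective
    (hwper.tendsto_atTop_intervalIntegral_of_pos' (hint 0 1) hw one_pos)
    (hwper.tendsto_atBot_intervalIntegral_of_pos' (hint 0 1) hw one_pos)
  have hΘadd : ∀ x, Θ (x + 1) = Θ x + T := fun x => by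
    simpa [Θ, hT] using hwper.intervalIntegral_add_eq_add 0 x hint
  have hΘd : ∀ x, x ∉ Set.range ((↑) : ℤ → ℝ) → HasDerivAt Θ (w x) x := by
    have hopen : IsOpen (Set.range ((↑) : ℤ → ℝ))ᶜ :=
      Int.isClosedEmbedding_coe_real.isClosed_range.isOpen_compl
    exact fun x hx => intervalIntegral.integral_hasDerivAt_right (hint 0 x)
      (hwc.stronglyMeasurableAtFilter hopen x hx) (hwc.continuousAt (hopen.mem_nhds hx))
  let e : ℝ ≃o ℝ := hΘmono.orderIsoOfSurjective Θ hΘsurj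
  have he : ∀ x, e x = Θ x := fun _ => rfl
  have hΘ0 : Θ 0 = 0 := intervalIntegral.integral_same
  have hτ0 : e.symm 0 = 0 := by rw [e.symm_apply_eq, he, hΘ0]
  have hτT : e.symm T = 1 := by rw [e.symm_apply_eq, he]
  have hτadd : ∀ u, e.symm (u + T) = e.symm u + 1 := fun u => by
    rw [e.symm_apply_eq, he, hΘadd, ← he, e.apply_symm_apply]
  have hτc : Continuous e.symm := e.symm.continuous
  let σ : ℝ → ℝ := fun u => e.symm (T * u)
  have hσc : Continuous σ := hτc.comp (continuous_const.mul continuous_id)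
  have hσinj : Function.Injective σ := fun a b hab =>
    mul_left_cancel₀ hTpos.ne' (e.symm.injective hab)
  have hσd : ∀ u, σ u ∉ Set.range ((↑) : ℤ → ℝ) → HasDerivAt σ ((w (σ u))⁻¹ * T) u := by
    intro u hu
    have h1 : HasDerivAt e.symm (w (σ u))⁻¹ (T * u) :=
      (hΘd _ hu).of_local_left_inverse hτc.continuousAt (hw _).ne'
        (.of_forall fun y => e.apply_symm_apply y)
    have h2 : HasDerivAt (fun u => T * u) T u := by simpa using (hasDerivAt_id u).const_mul T
    exact h1.comp u h2
  have hδd : ∀ u, HasDerivAt (fun u => β (σ u)) (T • n (σ u)) u := by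
    refine hasDerivAt_of_hasDerivAt_off_countable
      ((Set.countable_range ((↑) : ℤ → ℝ)).preimage_of_injOn hσinj.injOn) (hβ.comp hσc)
      ((hn.comp hσc).const_smul T) fun u hu => ?_
    have := (hd _ hu).scomp u (hσd u hu)
    rwa [smul_smul, mul_right_comm, inv_mul_cancel₀ (hw (σ u)).ne', one_mul] at this
  have hσ0 : σ 0 = 0 := by simp [σ, hτ0]
  have hσ1 : σ 1 = 1 := by simp [σ, hτT]
  have hσmono : StrictMono σ := fun a b hab => e.symm.strictMono (by gcongr)
  refine ⟨fun u => β (σ u), ⟨?_, ?_, ?_, ?_⟩, ?_, by simp [hσ0], T, hTpos.ne', ?_⟩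
  · rw [contDiff_one_iff_deriv]
    refine ⟨fun u => (hδd u).differentiableAt, ?_⟩
    rw [funext fun u => (hδd u).deriv]
    exact (hn.comp hσc).const_smul T
  · intro u
    have : σ (u + 1) = σ u + 1 := by simp only [σ, mul_add, mul_one, hτadd]
    simp only [this, hβper (σ u)]
  · intro a ha b hb hab
    refine hσinj (hβinj ?_ ?_ hab)
    · exact ⟨hσ0 ▸ hσmono.monotone ha.1, hσ1 ▸ hσmono ha.2⟩
    · exact ⟨hσ0 ▸ hσmono.monotone hb.1, hσ1 ▸ hσmono hb.2⟩
  · intro t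
    rw [(hδd t).deriv]
    exact smul_ne_zero hTpos.ne' (hn0 _)
  · refine Function.Surjective.range_comp (f := σ) (fun x => ⟨T⁻¹ * e x, ?_⟩) β
    simp [σ, hTpos.ne']
  · rw [(hδd 0).deriv, hσ0]
/-- `f` fixes the origin and its derivative off the origin is a positive scalar `w` times a
continuous field `A` of invertible linear maps with `A 0 = 1`; the scalar may degenerate at the
origin. -/
structure HasDirectionField (f : Plane ≃ₜ Plane) (w : Plane → ℝ)
    (A : Plane → (Plane →L[ℝ] Plane)ˣ) : Prop where
  map_zero : f 0 = 0
  pos : ∀ x, 0 < w x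
  continuousOn : ContinuousOn w {0}ᶜ
  continuous : Continuous A
  field_zero : A 0 = 1
  hasFDerivAt : ∀ x, x ≠ 0 → HasFDerivAt f (w x • (A x : Plane →L[ℝ] Plane)) x

theorem HasDirectionField.symm {f : Plane ≃ₜ Plane} {w : Plane → ℝ}
    {A : Plane → (Plane →L[ℝ] Plane)ˣ} (h : HasDirectionField f w A) :
    HasDirectionField f.symm (fun y => (w (f.symm y))⁻¹) fun y => (A (f.symm y))⁻¹ := by
  have h0 : f.symm 0 = 0 := by rw [f.symm_apply_eq, h.map_zero]
  have hne : ∀ y, y ≠ 0 → f.symm y ≠ 0 := fun y hy hy0 => hy <| by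
    rw [← f.apply_symm_apply y, hy0, h.map_zero]
  refine ⟨h0, fun y => inv_pos.2 (h.pos _), ?_, ?_, by simp [h0, h.field_zero], fun y hy => ?_⟩
  · exact (h.continuousOn.comp f.symm.continuous.continuousOn hne).inv₀ fun y _ => (h.pos _).ne'
  · exact (h.continuous.comp f.symm.continuous).inv
  · have hw := (h.pos (f.symm y)).ne'
    let u : (Plane →L[ℝ] Plane)ˣ :=
      ⟨w (f.symm y) • (A (f.symm y) : Plane →L[ℝ] Plane),
        (w (f.symm y))⁻¹ • ((A (f.symm y))⁻¹ : (Plane →L[ℝ] Plane)ˣ),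
        by simp [smul_smul, hw], by simp [smul_smul, hw]⟩
    exact HasFDerivAt.of_local_left_inverse (f' := ContinuousLinearEquiv.unitsEquiv ℝ Plane u)
      f.symm.continuous.continuousAt (h.hasFDerivAt _ (hne y hy))
      (.of_forall f.apply_symm_apply)

theorem unit_apply_ne_zero (u : (Plane →L[ℝ] Plane)ˣ) {v : Plane} (hv : v ≠ 0) :
    (u : Plane →L[ℝ] Plane) v ≠ 0 :=
  (ContinuousLinearEquiv.unitsEquiv ℝ Plane u).map_ne_zero_iff.2 hv

theorem IsRegParam.injOn_comp {γ : ℝ → Plane} (hγ : IsRegParam γ) (f : Plane ≃ₜ Plane) :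
    Set.InjOn (fun t => f (γ t)) (Set.Ico 0 1) :=
  f.injective.comp_injOn hγ.2.2.1

theorem apply_fract_of_periodic {γ : ℝ → Plane} (hγ : Function.Periodic γ 1) (t : ℝ) :
    γ (Int.fract t) = γ t := by
  rw [← Int.self_sub_floor]
  simpa using hγ.sub_int_mul_eq (x := t) ⌊t⌋

theorem IsRegParam.comp_add_const {γ : ℝ → Plane} (hγ : IsRegParam γ) (a : ℝ) :
    IsRegParam fun t => γ (t + a) := by
  obtain ⟨h1, h2, h3, h4⟩ := hγ
  refine ⟨h1.comp (contDiff_id.add contDiff_const), fun t => ?_, fun s hs t ht hst => ?_,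
    fun t => ?_⟩
  · simp only [add_right_comm t 1 a, h2 (t + a)]
  · have key : Int.fract (s + a) = Int.fract (t + a) :=
      h3 ⟨Int.fract_nonneg _, Int.fract_lt_one _⟩ ⟨Int.fract_nonneg _, Int.fract_lt_one _⟩
        (by rw [apply_fract_of_periodic h2, apply_fract_of_periodic h2]; exact hst)
    obtain ⟨z, hz⟩ := Int.fract_eq_fract.1 key
    have h5 : (z : ℝ) < 1 := by linarith [hs.2, ht.1]
    have h6 : (-1 : ℝ) < z := by linarith [hs.1, ht.2]
    have h7 : z = 0 := by
      have : z < 1 := by exact_mod_cast h5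
      have : -1 < z := by exact_mod_cast h6
      lia
    rw [h7] at hz
    push_cast at hz
    linarith
  · rw [deriv_comp_add_const]
    exact h4 _

theorem IsRegParam.eq_zero_iff {γ : ℝ → Plane} (hγ : IsRegParam γ) (h0 : γ 0 = 0) (t : ℝ) :
    γ t = 0 ↔ t ∈ Set.range ((↑) : ℤ → ℝ) := by
  constructor
  · intro ht
    have : Int.fract t = 0 := hγ.2.2.1 ⟨Int.fract_nonneg _, Int.fract_lt_one _⟩ ⟨le_rfl, one_pos⟩
      (by rw [apply_fract_of_periodic hγ.2.1, ht, h0])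
    exact Int.fract_eq_zero_iff.1 this
  · rintro ⟨k, rfl⟩
    rw [← h0]
    simpa using hγ.2.1.int_mul_eq k

theorem HasDirectionField.isRegParam_comp {f : Plane ≃ₜ Plane} {w : Plane → ℝ}
    {A : Plane → (Plane →L[ℝ] Plane)ˣ} (h : HasDirectionField f w A) {γ : ℝ → Plane}
    (hγ : IsRegParam γ) (hγ0 : ∀ t, γ t ≠ 0) : IsRegParam fun t => f (γ t) := by
  have hd : ∀ t, HasDerivAt (fun t => f (γ t)) (w (γ t) • (A (γ t) : Plane →L[ℝ] Plane) (deriv γ t))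
      t := fun t => (h.hasFDerivAt _ (hγ0 t)).comp_hasDerivAt t
        ((hγ.1.differentiable one_ne_zero) t).hasDerivAt
  refine ⟨?_, fun t => congrArg f (hγ.2.1 t), hγ.injOn_comp f, fun t => ?_⟩
  · rw [contDiff_one_iff_deriv]
    refine ⟨fun t => (hd t).differentiableAt, ?_⟩
    rw [funext fun t => (hd t).deriv]
    have hc := hγ.1.continuous
    exact (continuousOn_univ.1 (h.continuousOn.comp hc.continuousOn fun t _ => hγ0 t)).smul
      ((Units.continuous_val.comp (h.continuous.comp hc)).clm_apply
        (contDiff_one_iff_deriv.1 hγ.1).2)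
  · rw [(hd t).deriv]
    exact smul_ne_zero (h.pos _).ne' (unit_apply_ne_zero _ (hγ.2.2.2 t))

theorem HasDirectionField.exists_isRegParam {f : Plane ≃ₜ Plane} {w : Plane → ℝ}
    {A : Plane → (Plane →L[ℝ] Plane)ˣ} (h : HasDirectionField f w A) {γ : ℝ → Plane}
    (hγ : IsRegParam γ) (hγ0 : γ 0 = 0) :
    ∃ δ : ℝ → Plane, IsRegParam δ ∧ Set.range δ = f '' Set.range γ ∧ δ 0 = 0 ∧
      ∃ c : ℝ, c ≠ 0 ∧ deriv δ 0 = c • deriv γ 0 := by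
  have hc := hγ.1.continuous
  have hne : ∀ t, t ∉ Set.range ((↑) : ℤ → ℝ) → γ t ≠ 0 := fun t ht h0 =>
    ht ((hγ.eq_zero_iff hγ0 t).1 h0)
  obtain ⟨δ, h1, h2, h3, c, hc0, h4⟩ := exists_isRegParam_of_direction
    (β := fun t => f (γ t)) (n := fun t => (A (γ t) : Plane →L[ℝ] Plane) (deriv γ t))
    (w := fun t => w (γ t)) (f.continuous.comp hc) (fun t => congrArg f (hγ.2.1 t))
    (hγ.injOn_comp f)
    ((Units.continuous_val.comp (h.continuous.comp hc)).clm_apply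
        (contDiff_one_iff_deriv.1 hγ.1).2)
    (fun t => unit_apply_ne_zero _ (hγ.2.2.2 t)) (fun t => congrArg w (hγ.2.1 t))
    (fun t => h.pos _) (h.continuousOn.comp hc.continuousOn hne)
    (fun t ht => (h.hasFDerivAt _ (hne t ht)).comp_hasDerivAt t
        ((hγ.1.differentiable one_ne_zero) t).hasDerivAt)
  refine ⟨δ, h1, by rw [h2, ← Set.range_comp]; rfl, by rw [h3, hγ0, h.map_zero], c, hc0, ?_⟩
  rw [h4, hγ0, h.field_zero]
  rfl

theorem range_comp_add_const {γ : ℝ → Plane} (a : ℝ) :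
    Set.range (fun t => γ (t + a)) = Set.range γ :=
  (Equiv.addRight a).surjective.range_comp γ

theorem HasDirectionField.tangentAt {f : Plane ≃ₜ Plane} {w : Plane → ℝ}
    {A : Plane → (Plane →L[ℝ] Plane)ˣ} (h : HasDirectionField f w A) {Γ : Set Plane} {ℓ : ProjLine}
    (hΓ : TangentAt Γ 0 ℓ) : TangentAt (f '' Γ) 0 ℓ := by
  obtain ⟨γ, t₀, hγ, rfl, h0, rfl⟩ := hΓ
  obtain ⟨δ, h1, h2, h3, c, hc, h4⟩ :=
    h.exists_isRegParam (hγ.comp_add_const t₀) (by simpa using h0)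
  rw [range_comp_add_const] at h2
  rw [deriv_comp_add_const, zero_add] at h4
  refine ⟨δ, 0, h1, h2.symm, h3, ?_⟩
  exact ((Projectivization.mk_eq_mk_iff' ℝ _ _ _ _).2 ⟨c, h4.symm⟩).symm

theorem HasDirectionField.mapsC1 {f : Plane ≃ₜ Plane} {w : Plane → ℝ}
    {A : Plane → (Plane →L[ℝ] Plane)ˣ} (h : HasDirectionField f w A) : MapsC1 f := by
  rintro _ ⟨γ, hγ, rfl⟩
  by_cases h0 : ∃ t₀, γ t₀ = 0
  · obtain ⟨t₀, ht₀⟩ := h0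
    obtain ⟨δ, _, hδ, hr, -⟩ := h.tangentAt ⟨γ, t₀, hγ, rfl, ht₀, rfl⟩
    exact ⟨δ, hδ, hr⟩
  · push Not at h0
    exact ⟨_, h.isRegParam_comp hγ h0, (Set.range_comp f γ).symm⟩

/-- The squared Euclidean norm. -/
def sqNorm (x : Plane) : ℝ := x.1 ^ 2 + x.2 ^ 2

theorem sqNorm_zero : sqNorm 0 = 0 := by simp [sqNorm]

theorem sqNorm_smul (a : ℝ) (x : Plane) : sqNorm (a • x) = a ^ 2 * sqNorm x := by
  simp only [sqNorm, Prod.smul_fst, Prod.smul_snd, smul_eq_mul]; ring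

theorem sqNorm_pos {x : Plane} (hx : x ≠ 0) : 0 < sqNorm x := by
  have h : 0 ≤ sqNorm x := by unfold sqNorm; positivity
  refine h.lt_of_ne fun h0 => hx ?_
  unfold sqNorm at h0
  ext
  · exact pow_eq_zero_iff two_ne_zero |>.1 (by nlinarith [sq_nonneg x.1, sq_nonneg x.2])
  · exact pow_eq_zero_iff two_ne_zero |>.1 (by nlinarith [sq_nonneg x.1, sq_nonneg x.2])

theorem continuous_sqNorm : Continuous sqNorm := by unfold sqNorm; fun_prop

theorem norm_sq_le_sqNorm (x : Plane) : ‖x‖ ^ 2 ≤ sqNorm x := by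
  unfold sqNorm
  rcases max_choice ‖x.1‖ ‖x.2‖ with h | h <;>
    rw [Prod.norm_def, h, Real.norm_eq_abs, sq_abs] <;> nlinarith [sq_nonneg x.1, sq_nonneg x.2]

theorem tendsto_log_sqNorm : Tendsto (fun x => Real.log (sqNorm x)) (𝓝[≠] 0) atBot := by
  refine Real.tendsto_log_nhdsGT_zero.comp (tendsto_nhdsWithin_iff.2 ⟨?_, ?_⟩)
  · exact (sqNorm_zero ▸ continuous_sqNorm.tendsto 0).mono_left nhdsWithin_le_nhds
  · exact eventually_mem_nhdsWithin.mono fun x hx => sqNorm_pos hx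

/-- The action of `x ↦ x / (5 + (log |x|²)²)` on the coordinate `log |x|²`. -/
def logRadial (s : ℝ) : ℝ := s - 2 * Real.log (5 + s ^ 2)

theorem strictMono_logRadial_sub : StrictMono fun s => logRadial s - s / 100 := by
  have hd : ∀ s : ℝ, HasDerivAt (fun s => logRadial s - s / 100)
      (1 - 2 * (2 * s / (5 + s ^ 2)) - 1 / 100) s := fun s => by
    have h1 : HasDerivAt (fun s : ℝ => 5 + s ^ 2) (2 * s) s := by
      simpa using ((hasDerivAt_id s).pow 2).const_add 5
    exact ((hasDerivAt_id s).sub ((h1.log (by positivity)).const_mul 2)).sub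
      ((hasDerivAt_id s).div_const 100)
  refine strictMono_of_deriv_pos fun s => ?_
  rw [(hd s).deriv]
  have hpos : 0 < 5 + s ^ 2 := by positivity
  have : 2 * s / (5 + s ^ 2) < 99 / 200 := by
    rw [div_lt_iff₀ hpos]; nlinarith [sq_nonneg (s - 2)]
  linarith

theorem continuous_logRadial : Continuous logRadial := by
  unfold logRadial
  exact continuous_id.sub (continuous_const.mul
    ((continuous_const.add (continuous_pow 2)).log fun s =>
      (by positivity : (5 : ℝ) + s ^ 2 ≠ 0)))

theorem strictMono_logRadial : StrictMono logRadial := fun a b hab => by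
  have : logRadial a - a / 100 < logRadial b - b / 100 := strictMono_logRadial_sub hab
  linarith

theorem surjective_logRadial : Function.Surjective logRadial := by
  refine continuous_logRadial.surjective ?_ ?_
  · refine tendsto_atTop_mono' atTop (f₁ := fun s => logRadial 0 + s / 100) ?_
      (tendsto_atTop_add_const_left _ _ (tendsto_id.atTop_div_const (by norm_num : (0 : ℝ) < 100)))
    filter_upwards [eventually_ge_atTop 0] with s hs
    have := strictMono_logRadial_sub.monotone hs
    linarith
  · refine tendsto_atBot_mono' atBot (f₁ := fun s => logRadial 0 + s / 100) ?_
      (tendsto_atBot_add_const_left _ _ (tendsto_id.atBot_div_const (by norm_num : (0 : ℝ) < 100)))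
    filter_upwards [eventually_le_atBot 0] with s hs
    have := strictMono_logRadial_sub.monotone hs
    linarith

/-- `logRadial` as an order isomorphism. -/
def logRadialIso : ℝ ≃o ℝ :=
  strictMono_logRadial.orderIsoOfSurjective logRadial surjective_logRadial

theorem logRadialIso_apply (s : ℝ) : logRadialIso s = logRadial s := rfl

/-- The radial factor `1 / (5 + (log |x|²)²)`. -/
def radialFactor (x : Plane) : ℝ := (5 + Real.log (sqNorm x) ^ 2)⁻¹

theorem radialFactor_pos (x : Plane) : 0 < radialFactor x := by unfold radialFactor; positivity

theorem continuousOn_radialFactor : ContinuousOn radialFactor {0}ᶜ :=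
  (continuousOn_const.add ((continuous_sqNorm.continuousOn.log
    fun _ hx => (sqNorm_pos hx).ne').pow 2)).inv₀ fun x _ =>
      (by positivity : 5 + Real.log (sqNorm x) ^ 2 ≠ 0)

theorem tendsto_radialFactor : Tendsto radialFactor (𝓝[≠] 0) (𝓝 0) := by
  refine tendsto_inv_atTop_zero.comp (tendsto_atTop_add_const_left _ _ ?_)
  have : Tendsto (fun s : ℝ => s ^ 2) atBot atTop := by
    simpa only [sq, id] using tendsto_id.atBot_mul_atBot₀ (tendsto_id (α := ℝ))
  exact this.comp tendsto_log_sqNorm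

theorem hasFDerivAt_radial_zero :
    HasFDerivAt (fun x => radialFactor x • x) (0 : Plane →L[ℝ] Plane) 0 := by
  rw [hasFDerivAt_iff_isLittleO_nhds_zero]
  have h : Tendsto (fun x : Plane => if x = 0 then 0 else radialFactor x) (𝓝 0) (𝓝 0) := by
    rw [← nhdsNE_sup_pure, tendsto_sup]
    constructor
    · refine tendsto_radialFactor.congr' ?_
      filter_upwards [self_mem_nhdsWithin] with x hx
      exact (if_neg hx).symm
    · rw [tendsto_pure_left]
      intro s hs
      simpa using mem_of_mem_nhds hs
  have := ((Asymptotics.isLittleO_one_iff ℝ).2 h).smul_isBigO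
    (Asymptotics.isBigO_refl (fun x : Plane => x) (𝓝 0))
  refine this.congr (fun x => ?_) fun x => by simp
  by_cases hx : x = 0 <;> simp [hx]

theorem log_sqNorm_radial {x : Plane} (hx : x ≠ 0) :
    Real.log (sqNorm (radialFactor x • x)) = logRadial (Real.log (sqNorm x)) := by
  rw [sqNorm_smul, radialFactor, Real.log_mul (by positivity) (sqNorm_pos hx).ne', Real.log_pow,
    Real.log_inv, logRadial]
  push_cast
  ring

theorem log_sqNorm_radial_inv {y : Plane} (hy : y ≠ 0) :
    Real.log (sqNorm ((5 + logRadialIso.symm (Real.log (sqNorm y)) ^ 2) • y)) =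
      logRadialIso.symm (Real.log (sqNorm y)) := by
  set s := logRadialIso.symm (Real.log (sqNorm y)) with hs
  have h1 : Real.log (sqNorm y) = s - 2 * Real.log (5 + s ^ 2) := by
    rw [← logRadialIso.apply_symm_apply (Real.log (sqNorm y)), ← hs]; rfl
  rw [sqNorm_smul, Real.log_mul (by positivity) (sqNorm_pos hy).ne', Real.log_pow, h1]
  push_cast
  ring

theorem continuous_radial_inv :
    Continuous fun y : Plane => (5 + logRadialIso.symm (Real.log (sqNorm y)) ^ 2) • y := by
  rw [continuous_iff_continuousAt]
  intro y
  by_cases hy : y = 0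
  · subst hy
    rw [← continuousWithinAt_compl_self, ContinuousWithinAt, smul_zero]
    have h1 : Tendsto (fun y => Real.exp (logRadialIso.symm (Real.log (sqNorm y)))) (𝓝[≠] 0)
        (𝓝 0) :=
      Real.tendsto_exp_atBot.comp (logRadialIso.symm.tendsto_atBot.comp tendsto_log_sqNorm)
    have h2 := (Real.continuous_sqrt.tendsto 0).comp h1
    rw [Real.sqrt_zero] at h2
    refine squeeze_zero_norm' ?_ h2
    filter_upwards [self_mem_nhdsWithin] with y hy
    have hpos := sqNorm_pos (smul_ne_zero
      (by positivity : 5 + logRadialIso.symm (Real.log (sqNorm y)) ^ 2 ≠ 0) hy)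
    have hexp := Real.exp_log hpos
    rw [log_sqNorm_radial_inv hy] at hexp
    rw [Function.comp_apply, hexp]
    exact Real.le_sqrt_of_sq_le (norm_sq_le_sqNorm _)
  · have h : ContinuousAt (fun y => Real.log (sqNorm y)) y :=
      continuous_sqNorm.continuousAt.log (sqNorm_pos hy).ne'
    exact (continuousAt_const.add
      ((logRadialIso.symm.continuous.continuousAt.comp h).pow 2)).smul continuousAt_id

theorem continuous_radial : Continuous fun x : Plane => radialFactor x • x := by
  rw [continuous_iff_continuousAt]
  intro x
  by_cases hx : x = 0
  · subst hx
    exact hasFDerivAt_radial_zero.continuousAt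
  · exact (continuousOn_radialFactor.continuousAt (isOpen_compl_singleton.mem_nhds hx)).smul
      continuousAt_id

/-- The homeomorphism `x ↦ x / (5 + (log |x|²)²)` of the plane. -/
def radialHomeo : Plane ≃ₜ Plane where
  toFun x := radialFactor x • x
  invFun y := (5 + logRadialIso.symm (Real.log (sqNorm y)) ^ 2) • y
  left_inv x := by
    by_cases hx : x = 0
    · simp [hx]
    · simp only [log_sqNorm_radial hx, ← logRadialIso_apply, OrderIso.symm_apply_apply]
      rw [smul_smul, radialFactor, mul_inv_cancel₀ (by positivity), one_smul]
  right_inv y := by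
    by_cases hy : y = 0
    · simp [hy]
    · simp only [radialFactor, log_sqNorm_radial_inv hy]
      rw [smul_smul, inv_mul_cancel₀ (by positivity), one_smul]
  continuous_toFun := continuous_radial
  continuous_invFun := continuous_radial_inv

/-- The orthogonal projection onto the line through `x` (zero at `x = 0`). -/
def radialProj (x : Plane) : Plane →L[ℝ] Plane :=
  (sqNorm x)⁻¹ •
    (x.1 • ContinuousLinearMap.fst ℝ ℝ ℝ + x.2 • ContinuousLinearMap.snd ℝ ℝ ℝ).smulRight x

theorem radialProj_mul_self (x : Plane) : radialProj x * radialProj x = radialProj x := by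
  by_cases hx : x = 0
  · simp [hx, radialProj]
  have h := (sqNorm_pos hx).ne'
  refine ContinuousLinearMap.ext fun v => ?_
  simp only [radialProj, mul_apply_eq_comp, smul_apply,
    ContinuousLinearMap.smulRight_apply, add_apply,
    ContinuousLinearMap.coe_fst', ContinuousLinearMap.coe_snd', smul_eq_mul, smul_smul,
    Prod.smul_fst, Prod.smul_snd]
  congr 1
  rw [inv_mul_eq_iff_eq_mul₀ h]
  field_simp
  rw [sqNorm]
  ring

theorem norm_radialProj_le (x : Plane) : ‖radialProj x‖ ≤ 2 := by
  by_cases hx : x = 0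
  · simp [hx, radialProj]
  have h := sqNorm_pos hx
  have h1 : ‖x.1 • ContinuousLinearMap.fst ℝ ℝ ℝ + x.2 • ContinuousLinearMap.snd ℝ ℝ ℝ‖
      ≤ 2 * ‖x‖ := by
    refine (norm_add_le _ _).trans ?_
    rw [norm_smul, norm_smul]
    have := mul_le_mul (norm_snd_le x) (ContinuousLinearMap.norm_snd_le ℝ ℝ ℝ) (norm_nonneg _)
      (norm_nonneg x)
    have := mul_le_mul (norm_fst_le x) (ContinuousLinearMap.norm_fst_le ℝ ℝ ℝ) (norm_nonneg _)
      (norm_nonneg x)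
    linarith
  rw [radialProj, norm_smul, ContinuousLinearMap.norm_smulRight_apply, norm_inv, Real.norm_eq_abs,
    abs_of_pos h, inv_mul_le_iff₀ h]
  nlinarith [norm_sq_le_sqNorm x, norm_nonneg x]

/-- The logarithmic derivative coefficient of the radial factor. -/
def radialCoeff (x : Plane) : ℝ := 4 * Real.log (sqNorm x) / (5 + Real.log (sqNorm x) ^ 2)

theorem radialCoeff_lt_one (x : Plane) : radialCoeff x < 1 := by
  rw [radialCoeff, div_lt_one (by positivity)]
  nlinarith [sq_nonneg (Real.log (sqNorm x) - 2)]

theorem tendsto_radialCoeff : Tendsto radialCoeff (𝓝[≠] 0) (𝓝 0) := by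
  have h : Tendsto (fun s : ℝ => 4 * s / (5 + s ^ 2)) atBot (𝓝 0) := by
    have h1 : Tendsto (fun s : ℝ => 4 * (-s⁻¹)) atBot (𝓝 0) := by
      simpa using (tendsto_inv_atBot_zero (𝕜 := ℝ)).neg.const_mul 4
    refine squeeze_zero_norm' ?_ h1
    filter_upwards [eventually_lt_atBot 0] with s hs
    rw [Real.norm_eq_abs, abs_div, abs_of_pos (by positivity : 0 < 5 + s ^ 2), abs_mul,
      abs_of_neg hs, abs_of_pos (by norm_num : (0 : ℝ) < 4), div_le_iff₀ (by positivity)]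
    have : 4 * -s⁻¹ * (5 + s ^ 2) = 4 * -s + 20 * (-s)⁻¹ := by
      field_simp
      ring
    rw [this]
    have : 0 < (-s)⁻¹ := inv_pos.2 (by linarith)
    linarith
  exact h.comp tendsto_log_sqNorm

/-- The derivative of `radialHomeo` divided by the radial factor. -/
def radialField (x : Plane) : (Plane →L[ℝ] Plane)ˣ where
  val := 1 - radialCoeff x • radialProj x
  inv := 1 + (radialCoeff x / (1 - radialCoeff x)) • radialProj x
  val_inv := by
    have h : 1 - radialCoeff x ≠ 0 := by linarith [radialCoeff_lt_one x]
    simp only [sub_mul, mul_add, mul_one, one_mul, smul_mul_assoc, mul_smul_comm,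
      radialProj_mul_self]
    match_scalars
    · ring
    · field_simp
      ring
  inv_val := by
    have h : 1 - radialCoeff x ≠ 0 := by linarith [radialCoeff_lt_one x]
    simp only [mul_sub, add_mul, mul_one, one_mul, smul_mul_assoc, mul_smul_comm,
      radialProj_mul_self]
    match_scalars
    · ring
    · field_simp
      ring

theorem radialField_zero : radialField 0 = 1 := by
  ext1
  simp [radialField, radialProj]

theorem continuous_radialField : Continuous radialField := by
  rw [Units.isOpenEmbedding_val.continuous_iff, continuous_iff_continuousAt]
  intro x
  refine continuousAt_const.sub ?_
  by_cases hx : x = 0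
  · subst hx
    rw [← continuousWithinAt_compl_self, ContinuousWithinAt,
      show radialCoeff 0 • radialProj 0 = 0 by simp [radialProj]]
    refine tendsto_radialCoeff.zero_smul_isBoundedUnder_le ?_
    exact isBoundedUnder_of ⟨2, norm_radialProj_le⟩
  · have hs : ContinuousAt sqNorm x := continuous_sqNorm.continuousAt
    have hl := hs.log (sqNorm_pos hx).ne'
    refine ((hl.const_mul 4).div (continuousAt_const.add (hl.pow 2))
      (by positivity : 5 + Real.log (sqNorm x) ^ 2 ≠ 0)).smul
      ((hs.inv₀ (sqNorm_pos hx).ne').smul ?_)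
    exact Continuous.continuousAt (by fun_prop)

theorem hasDirectionField_radialHomeo :
    HasDirectionField radialHomeo radialFactor radialField where
  map_zero := smul_zero (radialFactor 0)
  pos := radialFactor_pos
  continuousOn := continuousOn_radialFactor
  continuous := continuous_radialField
  field_zero := radialField_zero
  hasFDerivAt x hx := by
    have h0 := (sqNorm_pos hx).ne'
    have h1 : HasFDerivAt sqNorm ((2 * x.1) • ContinuousLinearMap.fst ℝ ℝ ℝ +
        (2 * x.2) • ContinuousLinearMap.snd ℝ ℝ ℝ) x := by
      have := ((hasFDerivAt_fst (𝕜 := ℝ) (p := x)).pow 2).add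
        ((hasFDerivAt_snd (𝕜 := ℝ) (p := x)).pow 2)
      rw [Nat.add_one_sub_one, pow_one, pow_one, nsmul_eq_mul, nsmul_eq_mul] at this
      exact this
    have h5 : (5 + Real.log (sqNorm x) ^ 2) ≠ 0 := by positivity
    have h2 := (hasDerivAt_inv h5).comp_hasFDerivAt x (((h1.log h0).pow 2).const_add 5)
    refine (h2.smul (hasFDerivAt_id x)).congr_fderiv (ContinuousLinearMap.ext fun v => ?_)
    simp [radialField, radialCoeff, radialFactor, radialProj, smul_smul, sub_eq_add_neg]
    rw [← neg_smul]
    congr 1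
    field_simp
    ring

theorem not_differentiableAt_radialHomeo_symm : ¬ DifferentiableAt ℝ radialHomeo.symm 0 := by
  intro h
  have h0 : radialHomeo.symm 0 = 0 := hasDirectionField_radialHomeo.symm.map_zero
  have h1 : HasFDerivAt radialHomeo (0 : Plane →L[ℝ] Plane) (radialHomeo.symm 0) := by
    rw [h0]
    exact hasFDerivAt_radial_zero
  have h2 := h1.comp 0 h.hasFDerivAt
  rw [radialHomeo.self_comp_symm, ContinuousLinearMap.zero_comp] at h2
  exact zero_ne_one (h2.unique (hasFDerivAt_id 0))

/-- There is an element of `Homeo¹(ℝ²)` fixing the origin, not differentiable at the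
origin, whose induced map on the projective tangent space at the origin is the identity. -/
theorem exists_nondiff_identity_on_tangents :
    ∃ f : Plane ≃ₜ Plane, f 0 = 0 ∧ InHomeo1 f ∧
      ¬ DifferentiableAt ℝ (⇑f) 0 ∧
      ∀ (Γ : Set Plane) (ℓ : ProjLine), TangentAt Γ 0 ℓ → TangentAt (⇑f '' Γ) 0 ℓ := by
  have h := hasDirectionField_radialHomeo
  exact ⟨radialHomeo.symm, h.symm.map_zero, ⟨h.symm.mapsC1, h.mapsC1⟩,
    not_differentiableAt_radialHomeo_symm, fun _ _ => h.symm.tangentAt⟩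
end
end
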